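/- arXiv:math/0504057 — 4 statements merged into one kernel-verified Lean document; each statement's English description precedes it below -/
import Mathlib

section
/- Let n ≥ 3 and 1 < p < n. The constant ((n−p)/p)^p in the L^p Hardy inequality is sharp: the infimum, over all φ ∈ C_c^∞(ℝⁿ \ {0}) with ∫_{ℝⁿ} |φ(x)|^p/‖x‖^p dx ≠ 0, of the quotient (∫_{ℝⁿ} ‖∇φ(x)‖^p dx) / (∫_{ℝⁿ} |φ(x)|^p/‖x‖^p dx) equals ((n−p)/p)^p. -/
open MeasureTheory

theorem mul_rpow_sub_one_mul_le {p a t : ℝ} (hp : 1 < p) (ha : 0 ≤ a) (ht : 0 ≤ t) :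
    p * (t ^ (p - 1) * a) ≤ a ^ p + (p - 1) * t ^ p := by
  have hpq := Real.HolderConjugate.conjExponent hp
  have h := Real.young_inequality_of_nonneg ha (Real.rpow_nonneg ht (p - 1)) hpq
  have hp1 : p - 1 ≠ 0 := by linarith
  rw [← Real.rpow_mul ht, Real.conjExponent, mul_div_cancel₀ _ hp1] at h
  have h2 := mul_le_mul_of_nonneg_left h (by linarith : 0 ≤ p)
  have hp0 : p ≠ 0 := by linarith
  have h3 : p * (a ^ p / p + t ^ p / (p / (p - 1))) = a ^ p + (p - 1) * t ^ p := by
    field_simp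
  rw [h3] at h2
  linarith

theorem norm_gradient {E : Type*} [NormedAddCommGroup E] [InnerProductSpace ℝ E]
    [CompleteSpace E] (f : E → ℝ) (x : E) : ‖gradient f x‖ = ‖fderiv ℝ f x‖ := by
  simp [gradient]

/-- Integration by parts against the Euler vector field, whose divergence is the dimension. -/
theorem integral_fderiv_apply_self {ι : Type*} [Fintype ι] {G : EuclideanSpace ℝ ι → ℝ}
    (hG : ContDiff ℝ 1 G) (hc : HasCompactSupport G) :
    ∫ x, fderiv ℝ G x x = -(Fintype.card ι * ∫ x, G x) := by
  classical
  have hd : Continuous (fderiv ℝ G) := hG.continuous_fderiv (by norm_num)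
  have hint (i : ι) : Integrable fun x : EuclideanSpace ℝ ι ↦
      x i * fderiv ℝ G x (EuclideanSpace.single i 1) := by
    refine Continuous.integrable_of_hasCompactSupport (by fun_prop) ?_
    exact (hc.fderiv_apply ℝ _).mul_left
  have hcoord (i : ι) : ∫ x, x i * fderiv ℝ G x (EuclideanSpace.single i 1) = -∫ x, G x := by
    have hf (x : EuclideanSpace ℝ ι) :
        fderiv ℝ (fun y : EuclideanSpace ℝ ι ↦ y i) x = EuclideanSpace.proj i :=
      (EuclideanSpace.proj i : EuclideanSpace ℝ ι →L[ℝ] ℝ).hasFDerivAt.fderiv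
    have h := integral_mul_fderiv_eq_neg_fderiv_mul_of_integrable (μ := volume)
      (f := fun y : EuclideanSpace ℝ ι ↦ y i) (g := G) (v := EuclideanSpace.single i 1)
      ?_ (hint i) ?_ (fun x _ ↦ by fun_prop) (fun x _ ↦ hG.differentiable (by norm_num) x)
    · simpa [hf] using h
    · simpa [hf] using hG.continuous.integrable_of_hasCompactSupport hc
    · refine Continuous.integrable_of_hasCompactSupport ?_ hc.mul_left
      have := hG.continuous
      fun_prop
  have hsum (x : EuclideanSpace ℝ ι) :
      fderiv ℝ G x x = ∑ i, x i * fderiv ℝ G x (EuclideanSpace.single i 1) := by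
    have h := congrArg (fderiv ℝ G x) ((EuclideanSpace.basisFun ι ℝ).sum_repr x)
    rw [map_sum] at h
    simpa using h.symm
  simp_rw [hsum]
  rw [integral_finsetSum _ fun i _ ↦ hint i]
  simp [hcoord]

theorem integrable_norm_fderiv_rpow {E : Type*} [NormedAddCommGroup E] [NormedSpace ℝ E]
    [MeasurableSpace E] [BorelSpace E] {μ : Measure E} [IsFiniteMeasureOnCompacts μ]
    {f : E → ℝ} (hf : ContDiff ℝ 1 f) (hc : HasCompactSupport f) {p : ℝ} (hp : 0 < p) :
    Integrable (fun x ↦ ‖fderiv ℝ f x‖ ^ p) μ := by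
  have hd : Continuous (fderiv ℝ f) := hf.continuous_fderiv (by norm_num)
  refine Continuous.integrable_of_hasCompactSupport
    (hd.norm.rpow_const fun _ ↦ .inr hp.le) ?_
  exact (hc.fderiv ℝ).comp_left (g := fun L ↦ ‖L‖ ^ p) (by simp [hp.ne'])

/-- The `L^p` Hardy inequality for functions supported away from the origin. -/
theorem hardy_inequality {ι : Type*} [Fintype ι] {p : ℝ} (hp : 1 < p)
    (hpn : p < Fintype.card ι) {φ : EuclideanSpace ℝ ι → ℝ} (hφ : ContDiff ℝ 1 φ)
    (hc : HasCompactSupport φ) (h0 : 0 ∉ tsupport φ) :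
    ((Fintype.card ι - p) / p) ^ p * ∫ x, |φ x| ^ p / ‖x‖ ^ p ≤ ∫ x, ‖gradient φ x‖ ^ p := by
  have hp0 : 0 < p := by linarith
  set n : ℝ := (Fintype.card ι : ℝ) with hn_def
  set c : ℝ := (n - p) / p with hc_def
  have hc0 : 0 < c := div_pos (by linarith) hp0
  set ψ : EuclideanSpace ℝ ι → ℝ := fun x ↦ φ x * ‖x‖⁻¹ with hψ_def
  have hψ : ContDiff ℝ 1 ψ := by
    rw [contDiff_iff_contDiffAt]
    intro x
    by_cases hx : x = 0
    · have hev : ψ =ᶠ[nhds x] fun _ ↦ 0 := by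
        rw [hx]
        filter_upwards [notMem_tsupport_iff_eventuallyEq.1 h0] with y hy
        simp [hψ_def, hy]
      exact contDiffAt_const.congr_of_eventuallyEq hev
    · exact hφ.contDiffAt.mul ((contDiffAt_norm ℝ hx).inv (by simpa using hx))
  have hcψ : HasCompactSupport ψ := hc.mul_right
  set G : EuclideanSpace ℝ ι → ℝ := fun x ↦ |ψ x| ^ p with hG_def
  have hG : ContDiff ℝ 1 G := hψ.norm_rpow hp
  have hcG : HasCompactSupport G :=
    hcψ.comp_left (g := fun t ↦ |t| ^ p) (by simp [hp0.ne'])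
  have hGint : Integrable G := hG.continuous.integrable_of_hasCompactSupport hcG
  have hDint : Integrable fun x ↦ fderiv ℝ G x x := by
    refine Continuous.integrable_of_hasCompactSupport
      ((hG.continuous_fderiv (by norm_num)).clm_apply continuous_id) ?_
    refine (hcG.fderiv ℝ).mono fun x hx h ↦ hx ?_
    simp [h]
  have hquot (x : EuclideanSpace ℝ ι) : |φ x| ^ p / ‖x‖ ^ p = G x := by
    simp only [hG_def, hψ_def, abs_mul, abs_inv, abs_norm]
    rw [← div_eq_mul_inv, Real.div_rpow (abs_nonneg _) (norm_nonneg _)]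
  have hEuler (x : EuclideanSpace ℝ ι) :
      -(fderiv ℝ G x x) ≤ p * (|ψ x| ^ (p - 1) * ‖fderiv ℝ φ x‖) + p * G x := by
    by_cases hx : x = 0
    · rw [hx]; simp only [map_zero, neg_zero]; positivity
    have hxn : 0 < ‖x‖ := norm_pos_iff.2 hx
    have hGd : HasFDerivAt G ((p * |ψ x| ^ (p - 2) * ψ x) • fderiv ℝ ψ x) x :=
      (hasDerivAt_abs_rpow (ψ x) hp).comp_hasFDerivAt x
        (hψ.differentiable (by norm_num) x).hasFDerivAt
    have hφψ : φ = fun y ↦ ψ y * ‖y‖ := by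
      funext y
      by_cases hy : y = 0
      · simp [hy, image_eq_zero_of_notMem_tsupport h0]
      · simp [hψ_def, hy]
    have hnd : HasFDerivAt (fun y : EuclideanSpace ℝ ι ↦ ‖y‖) (fderiv ℝ (‖·‖) x) x :=
      ((contDiffAt_norm ℝ hx (n := 1)).differentiableAt (by norm_num)).hasFDerivAt
    have hφd : fderiv ℝ φ x = ψ x • fderiv ℝ (‖·‖) x + ‖x‖ • fderiv ℝ ψ x := by
      rw [hφψ]
      exact ((hψ.differentiable (by norm_num) x).hasFDerivAt.mul hnd).fderiv
    have hself : fderiv ℝ (‖·‖) x x = ‖x‖ := hnd.differentiableAt.fderiv_norm_self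
    have hψd : ‖x‖ * fderiv ℝ ψ x x = fderiv ℝ φ x x - ψ x * ‖x‖ := by
      rw [hφd]; simp [hself]
    have hb : |fderiv ℝ φ x x| ≤ ‖fderiv ℝ φ x‖ * ‖x‖ := (fderiv ℝ φ x).le_opNorm x
    set b := fderiv ℝ ψ x x
    have hb' : |b + ψ x| ≤ ‖fderiv ℝ φ x‖ := by
      refine le_of_mul_le_mul_right ?_ hxn
      calc |b + ψ x| * ‖x‖ = |(b + ψ x) * ‖x‖| := by rw [abs_mul, abs_norm]
        _ = |fderiv ℝ φ x x| := by congr 1; linarith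
        _ ≤ _ := hb
    rw [hGd.fderiv]
    have hpow : |ψ x| ^ (p - 2) * |ψ x| = |ψ x| ^ (p - 1) ∨ ψ x = 0 := by
      by_cases h : ψ x = 0
      · exact .inr h
      · left
        rw [← Real.rpow_add_one (abs_ne_zero.2 h)]; ring_nf
    have hpow2 : |ψ x| ^ (p - 2) * ψ x * ψ x = G x := by
      by_cases h : ψ x = 0
      · simp [hG_def, h, hp0.ne']
      · rw [mul_assoc, ← abs_mul_abs_self, ← mul_assoc, ← Real.rpow_add_one (abs_ne_zero.2 h),
          ← Real.rpow_add_one (abs_ne_zero.2 h)]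
        simp only [hG_def]; ring_nf
    have hle : -(|ψ x| ^ (p - 2) * ψ x * (b + ψ x)) ≤
        |ψ x| ^ (p - 1) * ‖fderiv ℝ φ x‖ := by
      refine (neg_le_abs _).trans ?_
      rw [abs_mul, abs_mul, abs_of_nonneg (Real.rpow_nonneg (abs_nonneg _) _)]
      rcases hpow with h | h
      · rw [h]; gcongr
      · simp only [h, abs_zero, mul_zero, zero_mul]; positivity
    have := mul_le_mul_of_nonneg_left hle hp0.le
    simp only [smul_apply, smul_eq_mul]
    rw [← hpow2]
    change -(_ * b) ≤ _
    linarith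
  have hpt (x : EuclideanSpace ℝ ι) :
      ((1 - p) * c ^ p - c ^ (p - 1) * p) * G x + (-c ^ (p - 1)) * fderiv ℝ G x x ≤
        ‖fderiv ℝ φ x‖ ^ p := by
    have h1 := mul_rpow_sub_one_mul_le hp (norm_nonneg (fderiv ℝ φ x))
      (mul_nonneg hc0.le (abs_nonneg (ψ x)))
    rw [Real.mul_rpow hc0.le (abs_nonneg _), Real.mul_rpow hc0.le (abs_nonneg _)] at h1
    have h2 := mul_le_mul_of_nonneg_left (hEuler x) (Real.rpow_nonneg hc0.le (p - 1))
    change _ ≤ _ + (p - 1) * (c ^ p * G x) at h1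
    linarith
  simp_rw [hquot, norm_gradient]
  have hmono := integral_mono ((hGint.const_mul _).add (hDint.const_mul _))
    (integrable_norm_fderiv_rpow hφ hc hp0) hpt
  simp only [Pi.add_apply] at hmono
  rw [integral_add (hGint.const_mul _) (hDint.const_mul _), integral_const_mul,
    integral_const_mul, integral_fderiv_apply_self hG hcG] at hmono
  refine le_trans (le_of_eq ?_) hmono
  have hcp : c ^ p = c ^ (p - 1) * c := by
    rw [← Real.rpow_add_one hc0.ne']; ring_nf
  have hn : (Fintype.card ι : ℝ) = p * c + p := by
    rw [hc_def]; field_simp; simp [hn_def]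
  rw [hn, hcp]
  ring

/-- Integration of a radial function in logarithmic polar coordinates. -/
theorem integral_log_norm_div {E : Type*} [NormedAddCommGroup E] [NormedSpace ℝ E]
    [MeasurableSpace E] [BorelSpace E] [FiniteDimensional ℝ E] [Nontrivial E]
    (μ : Measure E) [μ.IsAddHaarMeasure] (f : ℝ → ℝ) :
    ∫ x, f (Real.log ‖x‖) / ‖x‖ ^ Module.finrank ℝ E ∂μ =
      Module.finrank ℝ E * μ.real (Metric.ball 0 1) * ∫ s, f s := by
  rw [integral_fun_norm_addHaar μ fun r ↦ f (Real.log r) / r ^ Module.finrank ℝ E,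
    ← Real.range_exp, ← Set.image_univ,
    integral_image_eq_integral_abs_deriv_smul MeasurableSet.univ
      (fun x _ ↦ (Real.hasDerivAt_exp x).hasDerivWithinAt) Real.exp_injective.injOn]
  simp only [nsmul_eq_mul, smul_eq_mul, Real.log_exp, Measure.restrict_univ, mul_assoc]
  congr 3
  funext s
  obtain ⟨k, hk⟩ : ∃ k, Module.finrank ℝ E = k + 1 :=
    Nat.exists_eq_succ_of_ne_zero Module.finrank_pos.ne'
  rw [hk, Nat.add_sub_cancel, abs_of_pos (Real.exp_pos s)]
  field_simp
  ring

/-- The derivative of a function of `log ‖x‖`, measured in norm. -/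
theorem norm_fderiv_comp_log_norm {E : Type*} [NormedAddCommGroup E] [InnerProductSpace ℝ E]
    [Nontrivial E] {h : ℝ → ℝ} {x : E} (hx : x ≠ 0)
    (hh : DifferentiableAt ℝ h (Real.log ‖x‖)) :
    ‖fderiv ℝ (fun y : E ↦ h (Real.log ‖y‖)) x‖ = |deriv h (Real.log ‖x‖)| / ‖x‖ := by
  have hxn : ‖x‖ ≠ 0 := norm_ne_zero_iff.2 hx
  have hnd : DifferentiableAt ℝ (fun y : E ↦ ‖y‖) x :=
    (contDiffAt_norm ℝ hx (n := 1)).differentiableAt (by norm_num)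
  have hd : HasFDerivAt (fun y : E ↦ h (Real.log ‖y‖))
      ((deriv h (Real.log ‖x‖) * ‖x‖⁻¹) • fderiv ℝ (‖·‖) x) x :=
    (hh.hasDerivAt.comp ‖x‖ (Real.hasDerivAt_log hxn)).comp_hasFDerivAt x hnd.hasFDerivAt
  rw [hd.fderiv, norm_smul, norm_fderiv_norm hnd, mul_one, norm_mul, norm_inv, norm_norm,
    Real.norm_eq_abs, div_eq_mul_inv]

/-- A function of `log ‖x‖` whose profile is supported in `[a, b]` is supported in an annulus. -/
theorem tsupport_comp_log_norm_subset {E : Type*} [NormedAddCommGroup E] {h : ℝ → ℝ} {a b : ℝ}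
    (ha : 0 < a) (hh : ∀ s ∉ Set.Icc a b, h s = 0) :
    tsupport (fun y : E ↦ h (Real.log ‖y‖)) ⊆
      {y | Real.exp a ≤ ‖y‖} ∩ Metric.closedBall 0 (Real.exp b) := by
  refine closure_minimal ?_
    ((isClosed_le continuous_const continuous_norm).inter Metric.isClosed_closedBall)
  intro y hy
  have hs : Real.log ‖y‖ ∈ Set.Icc a b := by
    by_contra hs
    exact hy (hh _ hs)
  have hpos : 0 < ‖y‖ := by
    refine (norm_nonneg y).lt_of_ne' fun h0 ↦ ?_
    rw [h0, Real.log_zero] at hs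
    exact absurd hs.1 (not_le.2 ha)
  exact ⟨(Real.le_log_iff_exp_le hpos).1 hs.1,
    by simpa using (Real.log_le_iff_le_exp hpos).1 hs.2⟩

theorem contDiff_comp_log_norm {E : Type*} [NormedAddCommGroup E] [InnerProductSpace ℝ E]
    {h : ℝ → ℝ} {k : WithTop ℕ∞} {a b : ℝ} (ha : 0 < a) (hh : ∀ s ∉ Set.Icc a b, h s = 0)
    (hs : ContDiff ℝ k h) : ContDiff ℝ k (fun y : E ↦ h (Real.log ‖y‖)) := by
  rw [contDiff_iff_contDiffAt]
  intro x
  by_cases hx : x ∈ tsupport fun y : E ↦ h (Real.log ‖y‖)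
  swap
  · exact contDiffAt_const.congr_of_eventuallyEq (notMem_tsupport_iff_eventuallyEq.1 hx)
  have hx0 : x ≠ 0 := by
    rintro rfl
    have : Real.exp a ≤ ‖(0 : E)‖ := (tsupport_comp_log_norm_subset ha hh hx).1
    rw [norm_zero] at this
    exact absurd this (not_le.2 (Real.exp_pos a))
  exact hs.contDiffAt.comp x ((contDiffAt_norm ℝ hx0).log (norm_ne_zero_iff.2 hx0))

theorem exp_log_mul_rpow {r : ℝ} (hr : 0 < r) (n : ℕ) {p : ℝ} (hp : 0 < p) (t : ℝ) :
    |t * Real.exp (-((n - p) / p) * Real.log r)| ^ p / r ^ p = |t| ^ p / r ^ n := by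
  rw [abs_mul, Real.abs_exp, Real.mul_rpow (abs_nonneg _) (Real.exp_pos _).le,
    ← Real.exp_mul, ← Real.rpow_natCast r n, Real.rpow_def_of_pos hr p,
    Real.rpow_def_of_pos hr (n : ℝ), mul_div_assoc, ← Real.exp_sub,
    div_eq_mul_inv _ (Real.exp _), ← Real.exp_neg]
  congr 2
  field_simp
  ring

theorem continuous_integral_abs_mul_add_rpow {u v : ℝ → ℝ} (hu : Continuous u)
    (hv : Continuous v) (huc : HasCompactSupport u) (hvc : HasCompactSupport v) {p : ℝ}
    (hp : 0 < p) : Continuous fun δ : ℝ ↦ ∫ s, |δ * u s + v s| ^ p := by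
  rw [← continuousOn_univ]
  refine continuousOn_integral_of_compact_support (huc.isCompact.union hvc.isCompact) ?_ ?_
  · refine Continuous.continuousOn ?_
    refine Continuous.rpow_const ?_ fun _ ↦ .inr hp.le
    fun_prop
  · intro δ s _ hs
    simp only [Set.mem_union, not_or] at hs
    simp [image_eq_zero_of_notMem_tsupport hs.1, image_eq_zero_of_notMem_tsupport hs.2, hp.ne']

/-- The Hardy quotients of truncations, with logarithmic cut-off, of the virtual extremal
`‖x‖ ^ (-(n - p) / p)`. -/
theorem exists_hardy_quotient_eq {n : ℕ} {E : Type*} [NormedAddCommGroup E]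
    [InnerProductSpace ℝ E] [MeasurableSpace E] [BorelSpace E] [FiniteDimensional ℝ E]
    [Nontrivial E] (hn : Module.finrank ℝ E = n) (μ : Measure E) [μ.IsAddHaarMeasure]
    {p : ℝ} (hp : 0 < p) {χ : ℝ → ℝ} (hχ : ContDiff ℝ (⊤ : ℕ∞) χ) {a b : ℝ} (ha : 0 < a)
    (hab : ∀ s ∉ Set.Icc a b, χ s = 0) (hχp : ∫ s, |χ s| ^ p ≠ 0) {δ : ℝ} (hδ : 0 < δ) :
    ∃ φ : E → ℝ, ContDiff ℝ (⊤ : ℕ∞) φ ∧ HasCompactSupport φ ∧ (0 : E) ∉ tsupport φ ∧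
      (∫ x, |φ x| ^ p / ‖x‖ ^ p ∂μ) ≠ 0 ∧
      (∫ x, ‖gradient φ x‖ ^ p ∂μ) / (∫ x, |φ x| ^ p / ‖x‖ ^ p ∂μ) =
        (∫ s, |δ * deriv χ s + -((n - p) / p) * χ s| ^ p) / ∫ s, |χ s| ^ p := by
  set c : ℝ := (n - p) / p with hc_def
  set h : ℝ → ℝ := fun s ↦ χ (δ * s) * Real.exp (-c * s) with hh_def
  have hh : ContDiff ℝ (⊤ : ℕ∞) h := by
    refine (hχ.comp (contDiff_const.mul contDiff_id)).mul ?_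
    exact Real.contDiff_exp.comp (contDiff_const.mul contDiff_id)
  have hsupp : ∀ s ∉ Set.Icc (a / δ) (b / δ), h s = 0 := by
    intro s hs
    have : χ (δ * s) = 0 := hab _ fun hmem ↦ hs
      ⟨(div_le_iff₀' hδ).2 hmem.1, (le_div_iff₀' hδ).2 hmem.2⟩
    simp [hh_def, this]
  have hderiv (s : ℝ) :
      deriv h s = (δ * deriv χ (δ * s) + -c * χ (δ * s)) * Real.exp (-c * s) := by
    have h1 : HasDerivAt (fun s ↦ χ (δ * s)) (deriv χ (δ * s) * (δ * 1)) s :=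
      ((hχ.differentiable (by simp) (δ * s)).hasDerivAt).comp s
        ((hasDerivAt_id s).const_mul δ)
    have h2 : HasDerivAt (fun s ↦ Real.exp (-c * s)) (Real.exp (-c * s) * (-c * 1)) s :=
      ((hasDerivAt_id s).const_mul (-c)).exp
    refine (h1.mul h2).deriv.trans ?_
    ring
  have haδ : 0 < a / δ := div_pos ha hδ
  have hts := tsupport_comp_log_norm_subset (E := E) haδ hsupp
  have hrescale (f : ℝ → ℝ) :
      ∫ x, f (δ * Real.log ‖x‖) / ‖x‖ ^ n ∂μ =
        n * μ.real (Metric.ball 0 1) * δ⁻¹ * ∫ s, f s := by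
    rw [← hn, integral_log_norm_div μ fun s ↦ f (δ * s), Measure.integral_comp_mul_left,
      abs_of_pos (inv_pos.2 hδ), smul_eq_mul, mul_assoc _ δ⁻¹]
  have hne : ∀ᵐ x ∂μ, x ≠ (0 : E) := Measure.ae_ne μ 0
  have hden : ∫ x, |h (Real.log ‖x‖)| ^ p / ‖x‖ ^ p ∂μ =
      n * μ.real (Metric.ball 0 1) * δ⁻¹ * ∫ s, |χ s| ^ p := by
    rw [← hrescale fun s ↦ |χ s| ^ p]
    refine integral_congr_ae ?_
    filter_upwards [hne] with x hx
    exact exp_log_mul_rpow (norm_pos_iff.2 hx) n hp _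
  have hnum : ∫ x, ‖gradient (fun y : E ↦ h (Real.log ‖y‖)) x‖ ^ p ∂μ =
      n * μ.real (Metric.ball 0 1) * δ⁻¹ * ∫ s, |δ * deriv χ s + -c * χ s| ^ p := by
    rw [← hrescale fun s ↦ |δ * deriv χ s + -c * χ s| ^ p]
    refine integral_congr_ae ?_
    filter_upwards [hne] with x hx
    rw [norm_gradient, norm_fderiv_comp_log_norm hx (hh.differentiable (by simp) _),
      Real.div_rpow (abs_nonneg _) (norm_nonneg _), hderiv]
    exact exp_log_mul_rpow (norm_pos_iff.2 hx) n hp _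
  have hK : (n : ℝ) * μ.real (Metric.ball 0 1) * δ⁻¹ ≠ 0 := by
    have h1 : (n : ℝ) ≠ 0 := by
      rw [← hn]
      exact_mod_cast Module.finrank_pos.ne'
    have h2 : 0 < μ.real (Metric.ball (0 : E) 1) :=
      ENNReal.toReal_pos (Metric.measure_ball_pos μ 0 one_pos).ne' measure_ball_lt_top.ne
    positivity
  refine ⟨fun y ↦ h (Real.log ‖y‖), contDiff_comp_log_norm haδ hsupp hh, ?_, ?_, ?_, ?_⟩
  · exact (isCompact_closedBall 0 _).of_isClosed_subset (isClosed_tsupport _)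
      (hts.trans Set.inter_subset_right)
  · intro h0
    have : Real.exp (a / δ) ≤ ‖(0 : E)‖ := (hts h0).1
    rw [norm_zero] at this
    exact absurd this (not_le.2 (Real.exp_pos _))
  · rw [hden]
    exact mul_ne_zero hK hχp
  · rw [hden, hnum, mul_div_mul_left _ _ hK]

/-- **Sharpness of the constant in the Euclidean L^p Hardy inequality**
(sharpness assertion of Theorem 3.1 in the Euclidean case):
the infimum of the Hardy quotients over all smooth compactly supported
`φ` with support in `ℝⁿ \ {0}` and nonvanishing weighted denominator
equals `((n-p)/p)^p`. -/
theorem hardy_constant_sharp_euclidean (n : ℕ) (hn : 3 ≤ n) (p : ℝ)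
    (hp1 : 1 < p) (hpn : p < n) :
    IsGLB {r : ℝ | ∃ φ : EuclideanSpace ℝ (Fin n) → ℝ,
        ContDiff ℝ (⊤ : ℕ∞) φ ∧ HasCompactSupport φ ∧
        (0 : EuclideanSpace ℝ (Fin n)) ∉ tsupport φ ∧
        (∫ x, |φ x| ^ p / ‖x‖ ^ p) ≠ 0 ∧
        r = (∫ x, ‖gradient φ x‖ ^ p) / (∫ x, |φ x| ^ p / ‖x‖ ^ p)}
      (((n - p) / p) ^ p) := by
  have hp0 : 0 < p := by linarith
  constructor
  · rintro r ⟨φ, hφ, hc, h0, hne, rfl⟩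
    have hpos : 0 < ∫ x, |φ x| ^ p / ‖x‖ ^ p :=
      (integral_nonneg fun x ↦ by positivity).lt_of_ne' hne
    rw [le_div_iff₀ hpos]
    simpa using hardy_inequality hp1 (by simpa using hpn) (hφ.of_le (by simp)) hc h0
  · intro r hr
    have : NeZero n := ⟨by lia⟩
    have hc0 : 0 < (n - p) / p := div_pos (by linarith) hp0
    let χ : ContDiffBump (2 : ℝ) := ⟨1 / 2, 1, by norm_num, by norm_num⟩
    have hχ : ContDiff ℝ (⊤ : ℕ∞) χ := χ.contDiff
    have hab : ∀ s ∉ Set.Icc (1 : ℝ) 3, χ s = 0 := by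
      intro s hs
      by_contra h
      have hs' : s ∈ Metric.ball (2 : ℝ) 1 := χ.support_eq ▸ h
      rw [Real.ball_eq_Ioo] at hs'
      exact hs ⟨by linarith [hs'.1], by linarith [hs'.2]⟩
    have hχp : ∫ s, |χ s| ^ p ≠ 0 := by
      have hcont : Continuous fun s ↦ |χ s| ^ p :=
        χ.continuous.abs.rpow_const fun _ ↦ .inr hp0.le
      refine (hcont.integral_pos_of_hasCompactSupport_nonneg_nonzero
        (χ.hasCompactSupport.comp_left (g := fun t ↦ |t| ^ p) (by simp [hp0.ne']))
        (fun s ↦ by positivity) (x := 2) ?_).ne'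
      rw [χ.one_of_mem_closedBall (by simp [χ.rIn_pos.le])]
      simp
    have hlim := ((continuous_integral_abs_mul_add_rpow (hχ.continuous_deriv (by simp))
      (χ.continuous.const_mul (-((n - p) / p))) χ.hasCompactSupport.deriv
      χ.hasCompactSupport.mul_left hp0).div_const (∫ s, |χ s| ^ p)).tendsto 0
    have h0 : (∫ s, |0 * deriv χ s + -((n - p) / p) * χ s| ^ p) / ∫ s, |χ s| ^ p =
        ((n - p) / p) ^ p := by
      simp only [zero_mul, zero_add, abs_mul, abs_neg, abs_of_pos hc0]
      simp_rw [Real.mul_rpow hc0.le (abs_nonneg _)]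
      rw [integral_const_mul, mul_div_cancel_right₀ _ hχp]
    rw [h0] at hlim
    refine ge_of_tendsto (hlim.mono_left (nhdsWithin_le_nhds (s := Set.Ioi 0))) ?_
    filter_upwards [self_mem_nhdsWithin] with δ hδ
    obtain ⟨φ, h1, h2, h3, h4, h5⟩ := exists_hardy_quotient_eq
      (E := EuclideanSpace ℝ (Fin n)) (n := n) (by simp) volume hp0 hχ one_pos hab hχp hδ
    exact hr ⟨φ, h1, h2, h3, h4, h5.symm⟩
end

section
/- Let n ≥ 1, Q = 2n + 2 and 1 < p < Q. Then for every smooth function φ : ℝ^{2n+1} → ℝ with compact support contained in ℝ^{2n+1} \ {0}, one has ∫_{ℝ^{2n+1}} ‖∇_H φ‖^p dz dt ≥ ((Q−p)/p)^p ∫_{ℝ^{2n+1}} (|z|^p / (|z|⁴ + t²)^{p/2}) |φ|^p dz dt. -/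
open MeasureTheory

/-- A point of the Heisenberg group `Hⁿ ≅ ℝⁿ × ℝⁿ × ℝ`, coordinates `(x, y, t)`. -/
abbrev Heisenberg (n : ℕ) :=
  EuclideanSpace ℝ (Fin n) × EuclideanSpace ℝ (Fin n) × ℝ

/-- The horizontal vector field `X_j = ∂/∂x_j + 2 y_j ∂/∂t` applied to `f`. -/
noncomputable def heisX {n : ℕ} (j : Fin n) (f : Heisenberg n → ℝ)
    (q : Heisenberg n) : ℝ :=
  fderiv ℝ f q (EuclideanSpace.single j 1, 0, 2 * q.2.1 j)

/-- The horizontal vector field `Y_j = ∂/∂y_j − 2 x_j ∂/∂t` applied to `f`. -/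
noncomputable def heisY {n : ℕ} (j : Fin n) (f : Heisenberg n → ℝ)
    (q : Heisenberg n) : ℝ :=
  fderiv ℝ f q (0, EuclideanSpace.single j 1, -(2 * q.1 j))

/-- Squared norm of the horizontal gradient `∇_H f = (X₁f,…,Xₙf,Y₁f,…,Yₙf)`. -/
noncomputable def heisGradSq {n : ℕ} (f : Heisenberg n → ℝ)
    (q : Heisenberg n) : ℝ :=
  ∑ j : Fin n, ((heisX j f q) ^ 2 + (heisY j f q) ^ 2)

/-- The homogeneous norm `ρ(z,t) = (|z|⁴ + t²)^{1/4}` with `|z|² = ‖x‖² + ‖y‖²`. -/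
noncomputable def heisRho {n : ℕ} (q : Heisenberg n) : ℝ :=
  ((‖q.1‖ ^ 2 + ‖q.2.1‖ ^ 2) ^ 2 + q.2.2 ^ 2) ^ ((1 : ℝ) / 4)

namespace Heisenberg

variable {n : ℕ}

/-- The function `|z|²`. -/
noncomputable def radSq (q : Heisenberg n) : ℝ := ‖q.1‖ ^ 2 + ‖q.2.1‖ ^ 2

/-- The function `ρ⁴ = |z|⁴ + t²`. -/
noncomputable def gauge (q : Heisenberg n) : ℝ := radSq q ^ 2 + q.2.2 ^ 2

/-- The horizontal vector field `∇_H (ρ⁴) / 4`, in Euclidean coordinates. -/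
noncomputable def gaugeField (q : Heisenberg n) : Heisenberg n :=
  (radSq q • q.1 + q.2.2 • q.2.1, radSq q • q.2.1 - q.2.2 • q.1, 2 * q.2.2 * radSq q)

lemma radSq_nonneg (q : Heisenberg n) : 0 ≤ radSq q := by unfold radSq; positivity

lemma gauge_nonneg (q : Heisenberg n) : 0 ≤ gauge q := by unfold gauge; positivity

lemma radSq_eq_sum (q : Heisenberg n) :
    radSq q = ∑ j, (q.1 j ^ 2 + q.2.1 j ^ 2) := by
  simp [radSq, EuclideanSpace.real_norm_sq_eq, Finset.sum_add_distrib]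

lemma eq_zero_of_radSq_eq_zero {q : Heisenberg n} (h : radSq q = 0) : q.1 = 0 ∧ q.2.1 = 0 := by
  simpa using (add_eq_zero_iff_of_nonneg (sq_nonneg ‖q.1‖) (sq_nonneg ‖q.2.1‖)).1 h

lemma eq_zero_of_gauge_eq_zero {q : Heisenberg n} (h : gauge q = 0) : q = 0 := by
  have h1 : radSq q = 0 := by
    have := sq_nonneg (radSq q)
    have := sq_nonneg q.2.2
    unfold gauge at h
    exact pow_eq_zero_iff two_ne_zero |>.1 (by linarith)
  have h2 : q.2.2 = 0 := by simpa [gauge, h1] using h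
  obtain ⟨h3, h4⟩ := eq_zero_of_radSq_eq_zero h1
  exact Prod.ext h3 (Prod.ext h4 h2)

lemma gauge_pos {q : Heisenberg n} (h : q ≠ 0) : 0 < gauge q :=
  (gauge_nonneg q).lt_of_ne' fun h' => h (eq_zero_of_gauge_eq_zero h')

lemma contDiff_radSq : ContDiff ℝ 1 (radSq : Heisenberg n → ℝ) :=
  (contDiff_fst.norm_sq ℝ).add (contDiff_snd.fst.norm_sq ℝ)

lemma contDiff_gauge : ContDiff ℝ 1 (gauge : Heisenberg n → ℝ) :=
  (contDiff_radSq.pow 2).add (contDiff_snd.snd.pow 2)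

lemma fderiv_radSq_apply (q v : Heisenberg n) :
    fderiv ℝ radSq q v = 2 * (inner ℝ q.1 v.1 + inner ℝ q.2.1 v.2.1) := by
  have h : HasFDerivAt (radSq : Heisenberg n → ℝ) _ q :=
    (hasFDerivAt_fst (𝕜 := ℝ) (p := q)).norm_sq.add
      ((hasFDerivAt_snd (𝕜 := ℝ) (p := q)).fst.norm_sq)
  rw [h.fderiv]
  simp
  ring

lemma fderiv_gauge_apply (q v : Heisenberg n) :
    fderiv ℝ gauge q v = 2 * radSq q * fderiv ℝ radSq q v + 2 * q.2.2 * v.2.2 := by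
  have h : HasFDerivAt (gauge : Heisenberg n → ℝ) _ q :=
    ((contDiff_radSq.differentiable one_ne_zero q).hasFDerivAt.pow 2).add
      ((hasFDerivAt_snd (𝕜 := ℝ) (p := q)).snd.pow 2)
  rw [h.fderiv]
  simp

lemma fderiv_radSq_gaugeField (q : Heisenberg n) :
    fderiv ℝ radSq q (gaugeField q) = 2 * radSq q ^ 2 := by
  rw [fderiv_radSq_apply]
  simp only [gaugeField, inner_add_right, inner_sub_right, inner_smul_right,
    real_inner_self_eq_norm_sq, real_inner_comm q.2.1 q.1]
  simp only [radSq]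
  ring

lemma fderiv_gauge_gaugeField (q : Heisenberg n) :
    fderiv ℝ gauge q (gaugeField q) = 4 * radSq q * gauge q := by
  rw [fderiv_gauge_apply, fderiv_radSq_gaugeField]
  simp only [gaugeField, gauge]
  ring

lemma gaugeField_of_radSq_eq_zero {q : Heisenberg n} (h : radSq q = 0) : gaugeField q = 0 := by
  obtain ⟨h3, h4⟩ := eq_zero_of_radSq_eq_zero h
  simp [gaugeField, h, h3, h4]

instance : (volume : Measure (Heisenberg n)).IsAddHaarMeasure :=
  have : (volume : Measure (EuclideanSpace ℝ (Fin n) × ℝ)).IsAddHaarMeasure :=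
    Measure.prod.instIsAddHaarMeasure volume volume
  Measure.prod.instIsAddHaarMeasure volume volume

lemma integral_fderiv_apply_eq_zero {f : Heisenberg n → ℝ} (hf : ContDiff ℝ 1 f)
    (hfc : HasCompactSupport f) (v : Heisenberg n) : ∫ q, fderiv ℝ f q v = 0 := by
  have h1 : Integrable (fun q => fderiv ℝ f q v) :=
    ((hf.continuous_fderiv one_ne_zero).clm_apply continuous_const).integrable_of_hasCompactSupport
      (hfc.fderiv_apply ℝ v)
  have := integral_mul_fderiv_eq_neg_fderiv_mul_of_integrable (μ := (volume : Measure (Heisenberg n)))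
    (f := fun _ => (1 : ℝ)) (g := f) (v := v) (by simp) (by simpa using h1)
    (by simpa using hf.continuous.integrable_of_hasCompactSupport hfc)
    (by fun_prop) (fun x _ => hf.differentiable one_ne_zero x)
  simpa using this

lemma integral_leibniz_eq_zero {f c : Heisenberg n → ℝ} (hf : ContDiff ℝ 1 f)
    (hfc : HasCompactSupport f) (hc : ContDiff ℝ 1 c) (v : Heisenberg n) :
    Integrable (fun q => f q * fderiv ℝ c q v + c q * fderiv ℝ f q v) ∧
    ∫ q, (f q * fderiv ℝ c q v + c q * fderiv ℝ f q v) = 0 := by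
  have h : ∀ q, f q * fderiv ℝ c q v + c q * fderiv ℝ f q v
      = fderiv ℝ (fun q => f q * c q) q v := fun q => by
    rw [fderiv_fun_mul (hf.differentiable one_ne_zero q) (hc.differentiable one_ne_zero q)]
    simp
  simp_rw [h]
  have hs : HasCompactSupport fun q => f q * c q := hfc.mul_right
  exact ⟨(((hf.mul hc).continuous_fderiv one_ne_zero).clm_apply
    continuous_const).integrable_of_hasCompactSupport (hs.fderiv_apply ℝ v),
    integral_fderiv_apply_eq_zero (hf.mul hc) hs v⟩

lemma gaugeField_eq_sum (q : Heisenberg n) :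
    gaugeField q = ∑ j, ((gaugeField q).1 j • ((EuclideanSpace.single j 1, 0, 0) : Heisenberg n)
      + (gaugeField q).2.1 j • ((0, EuclideanSpace.single j 1, 0) : Heisenberg n))
      + (gaugeField q).2.2 • ((0, 0, 1) : Heisenberg n) := by
  refine Prod.ext ?_ (Prod.ext ?_ ?_)
  · ext i
    simp [Prod.fst_sum, Finset.sum_apply, Pi.single_apply]
  · ext i
    simp [Prod.snd_sum, Prod.fst_sum, Finset.sum_apply, Pi.single_apply]
  · simp [Prod.snd_sum]

lemma contDiff_gaugeField : ContDiff ℝ 1 (gaugeField : Heisenberg n → Heisenberg n) := by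
  have := contDiff_radSq (n := n)
  unfold gaugeField
  fun_prop

lemma fderiv_gaugeField_fst_apply (q v : Heisenberg n) (j : Fin n) :
    fderiv ℝ (fun q => (gaugeField q).1 j) q v
      = radSq q * v.1 j + q.1 j * fderiv ℝ radSq q v + q.2.2 * v.2.1 j + q.2.1 j * v.2.2 := by
  have hw := (contDiff_radSq.differentiable one_ne_zero q).hasFDerivAt
  have hx := (EuclideanSpace.proj (𝕜 := ℝ) j).hasFDerivAt.comp q
    (hasFDerivAt_fst (𝕜 := ℝ) (p := q))
  have hy := (EuclideanSpace.proj (𝕜 := ℝ) j).hasFDerivAt.comp q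
    (hasFDerivAt_snd (𝕜 := ℝ) (p := q)).fst
  have ht := (hasFDerivAt_snd (𝕜 := ℝ) (p := q)).snd
  have h : HasFDerivAt (fun q : Heisenberg n => (gaugeField q).1 j) _ q :=
    (hw.mul hx).add (ht.mul hy)
  rw [h.fderiv]
  simp
  ring

lemma fderiv_gaugeField_snd_apply (q v : Heisenberg n) (j : Fin n) :
    fderiv ℝ (fun q => (gaugeField q).2.1 j) q v
      = radSq q * v.2.1 j + q.2.1 j * fderiv ℝ radSq q v - q.2.2 * v.1 j - q.1 j * v.2.2 := by
  have hw := (contDiff_radSq.differentiable one_ne_zero q).hasFDerivAt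
  have hx := (EuclideanSpace.proj (𝕜 := ℝ) j).hasFDerivAt.comp q
    (hasFDerivAt_fst (𝕜 := ℝ) (p := q))
  have hy := (EuclideanSpace.proj (𝕜 := ℝ) j).hasFDerivAt.comp q
    (hasFDerivAt_snd (𝕜 := ℝ) (p := q)).fst
  have ht := (hasFDerivAt_snd (𝕜 := ℝ) (p := q)).snd
  have h : HasFDerivAt (fun q : Heisenberg n => (gaugeField q).2.1 j) _ q :=
    (hw.mul hy).sub (ht.mul hx)
  rw [h.fderiv]
  simp
  ring

lemma fderiv_gaugeField_vert_apply (q v : Heisenberg n) :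
    fderiv ℝ (fun q => (gaugeField q).2.2) q v
      = 2 * (q.2.2 * fderiv ℝ radSq q v + radSq q * v.2.2) := by
  have hw := (contDiff_radSq.differentiable one_ne_zero q).hasFDerivAt
  have ht := (hasFDerivAt_snd (𝕜 := ℝ) (p := q)).snd
  have h : HasFDerivAt (fun q : Heisenberg n => (gaugeField q).2.2) _ q :=
    (ht.const_mul 2).mul hw
  rw [h.fderiv]
  simp
  ring

/-- The divergence theorem for `f` times the field `∇_H (ρ⁴) / 4`, whose divergence is
`(Q + 2) |z|²`. -/
lemma integral_fderiv_gaugeField_eq_zero {f : Heisenberg n → ℝ} (hf : ContDiff ℝ 1 f)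
    (hfc : HasCompactSupport f) :
    ∫ q, (fderiv ℝ f q (gaugeField q) + (2 * n + 4) * radSq q * f q) = 0 := by
  have hGx (j : Fin n) : ContDiff ℝ 1 fun q : Heisenberg n => (gaugeField q).1 j :=
    (EuclideanSpace.proj (𝕜 := ℝ) j).contDiff.comp contDiff_gaugeField.fst
  have hGy (j : Fin n) : ContDiff ℝ 1 fun q : Heisenberg n => (gaugeField q).2.1 j :=
    (EuclideanSpace.proj (𝕜 := ℝ) j).contDiff.comp contDiff_gaugeField.snd.fst
  have hx (j : Fin n) := integral_leibniz_eq_zero hf hfc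
    (hGx j) (EuclideanSpace.single j 1, 0, 0)
  have hy (j : Fin n) := integral_leibniz_eq_zero hf hfc
    (hGy j) (0, EuclideanSpace.single j 1, 0)
  have ht := integral_leibniz_eq_zero hf hfc
    contDiff_gaugeField.snd.snd (0, 0, 1)
  have key (q : Heisenberg n) : fderiv ℝ f q (gaugeField q) + (2 * n + 4) * radSq q * f q =
      ∑ j, ((f q * fderiv ℝ (fun q => (gaugeField q).1 j) q (EuclideanSpace.single j 1, 0, 0)
          + (gaugeField q).1 j * fderiv ℝ f q (EuclideanSpace.single j 1, 0, 0))
        + (f q * fderiv ℝ (fun q => (gaugeField q).2.1 j) q (0, EuclideanSpace.single j 1, 0)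
          + (gaugeField q).2.1 j * fderiv ℝ f q (0, EuclideanSpace.single j 1, 0)))
      + (f q * fderiv ℝ (fun q => (gaugeField q).2.2) q (0, 0, 1)
          + (gaugeField q).2.2 * fderiv ℝ f q (0, 0, 1)) := by
    have h1 : fderiv ℝ f q (gaugeField q) = _ := congrArg _ (gaugeField_eq_sum q)
    rw [h1]
    simp only [map_add, map_sum, map_smul, smul_eq_mul, fderiv_gaugeField_fst_apply,
      fderiv_gaugeField_snd_apply, fderiv_gaugeField_vert_apply, fderiv_radSq_apply]
    have h2 : ∑ j, (f q * (2 * (q.1 j ^ 2 + q.2.1 j ^ 2)) + 2 * (f q * radSq q))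
        = (2 * n + 2) * radSq q * f q := by
      rw [Finset.sum_add_distrib, ← Finset.mul_sum, ← Finset.mul_sum, ← radSq_eq_sum]
      simp
      ring
    have h3 : (2 * n + 4) * radSq q * f q = (2 * n + 2) * radSq q * f q
      + 2 * radSq q * f q := by ring
    rw [h3, ← h2, add_add_add_comm, ← Finset.sum_add_distrib]
    congr 1
    · refine Finset.sum_congr rfl fun j _ => ?_
      simp [EuclideanSpace.inner_single_right]
      ring
    · simp
      ring
  simp_rw [key]
  have hi (j : Fin n) := (hx j).1.add (hy j).1
  simp only [Pi.add_def] at hi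
  rw [integral_add (integrable_finsetSum _ fun j _ => hi j) ht.1,
    integral_finsetSum _ fun j _ => hi j, ht.2, add_zero]
  refine Finset.sum_eq_zero fun j _ => ?_
  rw [integral_add (hx j).1 (hy j).1, (hx j).2, (hy j).2, add_zero]

lemma sum_gaugeField_sq (q : Heisenberg n) :
    ∑ j, ((gaugeField q).1 j ^ 2 + (gaugeField q).2.1 j ^ 2) = radSq q * gauge q := by
  rw [gauge, mul_comm]
  conv_rhs => rw [radSq_eq_sum, Finset.mul_sum, ← radSq_eq_sum]
  refine Finset.sum_congr rfl fun j _ => ?_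
  simp [gaugeField]
  ring

lemma fderiv_gaugeField_eq_sum (f : Heisenberg n → ℝ) (q : Heisenberg n) :
    fderiv ℝ f q (gaugeField q)
      = ∑ j, ((gaugeField q).1 j * heisX j f q + (gaugeField q).2.1 j * heisY j f q) := by
  simp only [heisX, heisY, ← smul_eq_mul, ← map_smul, ← map_add, ← map_sum]
  congr 1
  refine Prod.ext ?_ (Prod.ext ?_ ?_)
  · ext i
    simp [Prod.fst_sum, Finset.sum_apply, Pi.single_apply]
  · ext i
    simp [Prod.snd_sum, Prod.fst_sum, Finset.sum_apply, Pi.single_apply]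
  · simp only [Prod.snd_sum]
    simp only [gaugeField, radSq_eq_sum q, Finset.mul_sum]
    simp only [← radSq_eq_sum q]
    refine Finset.sum_congr rfl fun j _ => ?_
    simp
    ring

lemma abs_fderiv_gaugeField_le (f : Heisenberg n → ℝ) (q : Heisenberg n) :
    |fderiv ℝ f q (gaugeField q)| ≤ √(radSq q) * √(gauge q) * √(heisGradSq f q) := by
  rw [← Real.sqrt_mul (radSq_nonneg q), ← Real.sqrt_mul (mul_nonneg (radSq_nonneg q)
    (gauge_nonneg q)), fderiv_gaugeField_eq_sum, ← sum_gaugeField_sq, heisGradSq]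
  refine Real.abs_le_sqrt ?_
  have := Finset.sum_mul_sq_le_sq_mul_sq Finset.univ
    (Sum.elim (fun j => (gaugeField q).1 j) (fun j => (gaugeField q).2.1 j))
    (Sum.elim (fun j => heisX j f q) (fun j => heisY j f q))
  simpa [Finset.sum_add_distrib] using this

/-- A smooth regularization of `|z|^(p-2) ρ^(-2p)`. -/
noncomputable def regWeight (p ε : ℝ) (q : Heisenberg n) : ℝ :=
  (radSq q + ε) ^ ((p - 2) / 2) * (gauge q + ε) ^ (-(p / 2))

lemma contDiff_regWeight (p : ℝ) {ε : ℝ} (hε : 0 < ε) :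
    ContDiff ℝ 1 (regWeight p ε : Heisenberg n → ℝ) :=
  ((contDiff_radSq.add contDiff_const).rpow_const_of_ne
      fun q => (add_pos_of_nonneg_of_pos (radSq_nonneg q) hε).ne').mul
    ((contDiff_gauge.add contDiff_const).rpow_const_of_ne
      fun q => (add_pos_of_nonneg_of_pos (gauge_nonneg q) hε).ne')

lemma fderiv_regWeight_gaugeField (p : ℝ) {ε : ℝ} (hε : 0 < ε) (q : Heisenberg n) :
    fderiv ℝ (regWeight p ε) q (gaugeField q) = regWeight p ε q *
      (radSq q * ((p - 2) * (radSq q / (radSq q + ε)) - 2 * p * (gauge q / (gauge q + ε)))) := by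
  have hw : 0 < radSq q + ε := add_pos_of_nonneg_of_pos (radSq_nonneg q) hε
  have hN : 0 < gauge q + ε := add_pos_of_nonneg_of_pos (gauge_nonneg q) hε
  have h : HasFDerivAt (regWeight p ε : Heisenberg n → ℝ) _ q :=
    (((contDiff_radSq.differentiable one_ne_zero q).hasFDerivAt.add_const ε).rpow_const
        (p := (p - 2) / 2) (.inl hw.ne')).mul
      (((contDiff_gauge.differentiable one_ne_zero q).hasFDerivAt.add_const ε).rpow_const
        (p := -(p / 2)) (.inl hN.ne'))
  rw [h.fderiv]
  simp only [add_apply, smul_apply, smul_eq_mul, fderiv_radSq_gaugeField,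
    fderiv_gauge_gaugeField, Real.rpow_sub_one hw.ne', Real.rpow_sub_one hN.ne', regWeight]
  field_simp
  ring

lemma regWeight_mul_sqrt_le {p ε : ℝ} (hp : 1 < p) (hε : 0 < ε) (hε1 : ε ≤ 1)
    {q : Heisenberg n} (hq : q ≠ 0) :
    regWeight p ε q * √(radSq q) ≤ (radSq q + 1) ^ ((p - 1) / 2) * gauge q ^ (-(p / 2)) := by
  have hw0 := radSq_nonneg q
  have hw : 0 < radSq q + ε := add_pos_of_nonneg_of_pos hw0 hε
  calc regWeight p ε q * √(radSq q)
      ≤ regWeight p ε q * √(radSq q + ε) := by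
        have : 0 ≤ regWeight p ε q :=
          mul_nonneg (by positivity) (Real.rpow_nonneg (by linarith [gauge_nonneg q]) _)
        gcongr
        linarith
    _ = (radSq q + ε) ^ ((p - 1) / 2) * (gauge q + ε) ^ (-(p / 2)) := by
        rw [regWeight, Real.sqrt_eq_rpow, mul_right_comm, ← Real.rpow_add hw]
        ring_nf
    _ ≤ _ := by
        have h1 := gauge_pos hq
        refine mul_le_mul (Real.rpow_le_rpow hw.le (by linarith) (by linarith))
          (Real.rpow_le_rpow_of_nonpos h1 (by linarith) (by linarith))
          (Real.rpow_nonneg (by linarith) _) (Real.rpow_nonneg (by linarith) _)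

lemma abs_mul_abs_rpow_mul {p : ℝ} (hp : 1 < p) (a : ℝ) :
    |p * |a| ^ (p - 2) * a| = p * |a| ^ (p - 1) := by
  rw [abs_mul, abs_mul, abs_of_pos (by linarith : 0 < p), abs_of_nonneg (by positivity)]
  rcases eq_or_ne a 0 with rfl | ha
  · simp [Real.zero_rpow (by linarith : p - 1 ≠ 0)]
  · rw [mul_assoc, ← Real.rpow_add_one (abs_ne_zero.2 ha)]
    ring_nf

lemma continuous_heisGradSq {φ : Heisenberg n → ℝ} (hφ : ContDiff ℝ 1 φ) :
    Continuous (heisGradSq φ) := by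
  have h := hφ.continuous_fderiv one_ne_zero
  unfold heisGradSq heisX heisY
  fun_prop

lemma heisGradSq_eq_zero_of_notMem_tsupport {φ : Heisenberg n → ℝ} {q : Heisenberg n}
    (hq : q ∉ tsupport φ) : heisGradSq φ q = 0 := by
  simp [heisGradSq, heisX, heisY, fderiv_of_notMem_tsupport ℝ hq]

lemma integrable_mul_of_continuousOn {φ h k : Heisenberg n → ℝ} (hφc : HasCompactSupport φ)
    (hφ0 : (0 : Heisenberg n) ∉ tsupport φ) (hh : Continuous h)
    (hs : ∀ q ∉ tsupport φ, h q = 0) (hk : ContinuousOn k {0}ᶜ) :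
    Integrable fun q => k q * h q := by
  have hsub : tsupport (fun q => k q * h q) ⊆ tsupport φ :=
    closure_minimal (fun q hq => by
      by_contra hq'
      exact hq (by simp [hs q hq'])) (isClosed_tsupport φ)
  refine Continuous.integrable_of_hasCompactSupport (continuous_of_tsupport fun q hq => ?_)
    (hφc.of_isClosed_subset (isClosed_tsupport _) hsub)
  have hq0 : q ≠ 0 := fun h0 => hφ0 (h0 ▸ hsub hq)
  exact (hk.continuousAt (isOpen_compl_singleton.mem_nhds hq0)).mul hh.continuousAt

/-- Coefficient of `|φ|^p |z|²` in the divergence of `|φ|^p` times the regularized field. -/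
noncomputable def divCoeff (p ε : ℝ) (q : Heisenberg n) : ℝ :=
  2 * n + 4 + ((p - 2) * (radSq q / (radSq q + ε)) - 2 * p * (gauge q / (gauge q + ε)))

/-- The divergence of `|φ|^p` times the regularized field. -/
noncomputable def regDiv (p ε : ℝ) (φ : Heisenberg n → ℝ) (q : Heisenberg n) : ℝ :=
  regWeight p ε q * (p * |φ q| ^ (p - 2) * φ q * fderiv ℝ φ q (gaugeField q)
    + |φ q| ^ p * radSq q * divCoeff p ε q)

lemma regDiv_eq {p ε : ℝ} (hp : 1 < p) (hε : 0 < ε) {φ : Heisenberg n → ℝ}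
    (hφ : ContDiff ℝ 1 φ) (q : Heisenberg n) :
    regDiv p ε φ q = fderiv ℝ (fun q => |φ q| ^ p * regWeight p ε q) q (gaugeField q)
      + (2 * n + 4) * radSq q * (|φ q| ^ p * regWeight p ε q) := by
  have h1 : HasFDerivAt (fun q => |φ q| ^ p) _ q :=
    (hasDerivAt_abs_rpow (φ q) hp).comp_hasFDerivAt q
      (hφ.differentiable one_ne_zero q).hasFDerivAt
  rw [fderiv_fun_mul h1.differentiableAt
    ((contDiff_regWeight p hε).differentiable one_ne_zero q), h1.fderiv]
  simp only [add_apply, smul_apply, smul_eq_mul, fderiv_regWeight_gaugeField p hε, regDiv,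
    divCoeff]
  ring

lemma contDiff_abs_rpow_mul_regWeight {p ε : ℝ} (hp : 1 < p) (hε : 0 < ε)
    {φ : Heisenberg n → ℝ} (hφ : ContDiff ℝ 1 φ) :
    ContDiff ℝ 1 fun q => |φ q| ^ p * regWeight p ε q := by
  simpa using (hφ.norm_rpow hp).mul (contDiff_regWeight p hε)

lemma integral_regDiv {p ε : ℝ} (hp : 1 < p) (hε : 0 < ε) {φ : Heisenberg n → ℝ}
    (hφ : ContDiff ℝ 1 φ) (hφc : HasCompactSupport φ) : ∫ q, regDiv p ε φ q = 0 := by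
  simp_rw [regDiv_eq hp hε hφ]
  refine integral_fderiv_gaugeField_eq_zero (contDiff_abs_rpow_mul_regWeight hp hε hφ) ?_
  refine HasCompactSupport.mul_right (hφc.comp_left (g := fun x => |x| ^ p) ?_)
  simp [Real.zero_rpow (by linarith : p ≠ 0)]

lemma continuous_regDiv {p ε : ℝ} (hp : 1 < p) (hε : 0 < ε) {φ : Heisenberg n → ℝ}
    (hφ : ContDiff ℝ 1 φ) : Continuous (regDiv p ε φ) := by
  rw [funext (regDiv_eq hp hε hφ)]
  have h := contDiff_abs_rpow_mul_regWeight hp hε hφ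
  exact ((h.continuous_fderiv one_ne_zero).clm_apply contDiff_gaugeField.continuous).add
    ((continuous_const.mul contDiff_radSq.continuous).mul h.continuous)

/-- An integrable majorant of `regDiv p ε φ`, uniform in `0 < ε ≤ 1`. -/
noncomputable def regDivBound (p : ℝ) (φ : Heisenberg n → ℝ) (q : Heisenberg n) : ℝ :=
  (radSq q + 1) ^ ((p - 1) / 2) * gauge q ^ (-(p / 2)) *
    (p * |φ q| ^ (p - 1) * (√(gauge q) * √(heisGradSq φ q))
      + |φ q| ^ p * √(radSq q) * (2 * n + 4 + (|p - 2| + 2 * p)))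

lemma integrable_regDivBound {p : ℝ} (hp : 1 < p) {φ : Heisenberg n → ℝ}
    (hφ : ContDiff ℝ 1 φ) (hφc : HasCompactSupport φ) (hφ0 : (0 : Heisenberg n) ∉ tsupport φ) :
    Integrable (regDivBound p φ) := by
  have hw := (contDiff_radSq (n := n)).continuous
  have hN := (contDiff_gauge (n := n)).continuous
  refine integrable_mul_of_continuousOn hφc hφ0 ?_ (fun q hq => ?_) ?_
  · have h1 : Continuous fun q => |φ q| ^ (p - 1) :=
      hφ.continuous.abs.rpow_const fun _ => .inr (by linarith)
    have h2 : Continuous fun q => |φ q| ^ p :=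
      hφ.continuous.abs.rpow_const fun _ => .inr (by linarith)
    have h3 := continuous_heisGradSq hφ
    fun_prop
  · simp [image_eq_zero_of_notMem_tsupport hq, Real.zero_rpow (by linarith : p - 1 ≠ 0),
      Real.zero_rpow (by linarith : p ≠ 0)]
  · refine ContinuousOn.mul (ContinuousOn.rpow_const (by fun_prop) fun q _ => .inl ?_)
      (hN.continuousOn.rpow_const fun q hq => .inl (gauge_pos hq).ne')
    linarith [radSq_nonneg q]

lemma abs_divCoeff_le {p ε : ℝ} (hp : 1 < p) (hε : 0 < ε) (q : Heisenberg n) :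
    |divCoeff p ε q| ≤ 2 * n + 4 + (|p - 2| + 2 * p) := by
  have hd {x : ℝ} (hx : 0 ≤ x) : |x / (x + ε)| ≤ 1 := by
    rw [abs_of_nonneg (by positivity)]
    exact div_le_one_of_le₀ (by linarith) (by linarith)
  have h1 : |(p - 2) * (radSq q / (radSq q + ε))| ≤ |p - 2| := by
    rw [abs_mul]
    exact mul_le_of_le_one_right (abs_nonneg _) (hd (radSq_nonneg q))
  have h2 : |2 * p * (gauge q / (gauge q + ε))| ≤ 2 * p := by
    rw [abs_mul, abs_of_pos (by linarith : 0 < 2 * p)]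
    exact mul_le_of_le_one_right (by linarith) (hd (gauge_nonneg q))
  refine (abs_add_le _ _).trans (add_le_add ?_ ((abs_sub _ _).trans (add_le_add h1 h2)))
  rw [abs_of_nonneg (by positivity)]

lemma abs_regDiv_le {p ε : ℝ} (hp : 1 < p) (hε : 0 < ε) (hε1 : ε ≤ 1) {φ : Heisenberg n → ℝ}
    (hφ0 : (0 : Heisenberg n) ∉ tsupport φ) (q : Heisenberg n) :
    |regDiv p ε φ q| ≤ regDivBound p φ q := by
  rcases eq_or_ne q 0 with rfl | hq
  · have : φ 0 = 0 := image_eq_zero_of_notMem_tsupport hφ0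
    simp [regDiv, regDivBound, this, Real.zero_rpow (by linarith : p - 1 ≠ 0),
      Real.zero_rpow (by linarith : p ≠ 0)]
  have ha : 0 ≤ regWeight p ε q :=
    mul_nonneg (Real.rpow_nonneg (by linarith [radSq_nonneg q]) _)
      (Real.rpow_nonneg (by linarith [gauge_nonneg q]) _)
  have hw := Real.mul_self_sqrt (radSq_nonneg q)
  rw [regDiv, abs_mul, abs_of_nonneg ha]
  have h1 : |p * |φ q| ^ (p - 2) * φ q * fderiv ℝ φ q (gaugeField q)| ≤
      p * |φ q| ^ (p - 1) * (√(radSq q) * √(gauge q) * √(heisGradSq φ q)) := by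
    rw [abs_mul, abs_mul_abs_rpow_mul hp]
    gcongr
    exact abs_fderiv_gaugeField_le φ q
  have h2 : |(|φ q| ^ p * radSq q * divCoeff p ε q)| ≤
      |φ q| ^ p * (√(radSq q) * √(radSq q)) * (2 * n + 4 + (|p - 2| + 2 * p)) := by
    rw [hw, abs_mul, abs_of_nonneg (mul_nonneg (by positivity) (radSq_nonneg q))]
    have := radSq_nonneg q
    gcongr
    exact abs_divCoeff_le hp hε q
  calc _ ≤ regWeight p ε q * (p * |φ q| ^ (p - 1) * (√(radSq q) * √(gauge q) * √(heisGradSq φ q))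
        + |φ q| ^ p * (√(radSq q) * √(radSq q)) * (2 * n + 4 + (|p - 2| + 2 * p))) := by
        gcongr
        exact (abs_add_le _ _).trans (add_le_add h1 h2)
    _ = regWeight p ε q * √(radSq q) * (p * |φ q| ^ (p - 1) * (√(gauge q) * √(heisGradSq φ q))
        + |φ q| ^ p * √(radSq q) * (2 * n + 4 + (|p - 2| + 2 * p))) := by ring
    _ ≤ _ := by
        refine mul_le_mul_of_nonneg_right (regWeight_mul_sqrt_le hp hε hε1 hq) ?_
        have : 0 < p := by linarith
        positivity

/-- The pointwise limit of `regDiv p ε φ` as `ε → 0⁺`. -/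
noncomputable def limDiv (p : ℝ) (φ : Heisenberg n → ℝ) (q : Heisenberg n) : ℝ :=
  radSq q ^ ((p - 2) / 2) * gauge q ^ (-(p / 2)) *
    (p * |φ q| ^ (p - 2) * φ q * fderiv ℝ φ q (gaugeField q)
      + |φ q| ^ p * radSq q * (2 * n + 2 - p))

open Filter Topology in
lemma tendsto_regDiv (p : ℝ) (φ : Heisenberg n → ℝ) (q : Heisenberg n) :
    Tendsto (fun ε => regDiv p ε φ q) (𝓝[>] 0) (𝓝 (limDiv p φ q)) := by
  rcases (radSq_nonneg q).eq_or_lt' with hw | hw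
  · simp [regDiv, limDiv, hw, gaugeField_of_radSq_eq_zero hw]
  have hN : 0 < gauge q := by unfold gauge; positivity
  have hadd (x : ℝ) : Tendsto (fun ε => x + ε) (𝓝[>] 0) (𝓝 x) :=
    tendsto_nhdsWithin_of_tendsto_nhds (Continuous.tendsto' (by fun_prop) _ _ (by simp))
  have hdiv {x : ℝ} (hx : 0 < x) : Tendsto (fun ε => x / (x + ε)) (𝓝[>] 0) (𝓝 1) := by
    simpa [hx.ne', Pi.div_def] using (tendsto_const_nhds (x := x)).div (hadd x) hx.ne'
  have hcoeff : Tendsto (fun ε => divCoeff p ε q) (𝓝[>] 0) (𝓝 (2 * n + 2 - p)) := by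
    have := (((hdiv hw).const_mul (p - 2)).sub ((hdiv hN).const_mul (2 * p))).const_add
      (2 * (n : ℝ) + 4)
    rwa [show 2 * (n : ℝ) + 4 + ((p - 2) * 1 - 2 * p * 1) = 2 * n + 2 - p by ring] at this
  exact (((hadd _).rpow_const (.inl hw.ne')).mul ((hadd _).rpow_const (.inl hN.ne'))).mul
    ((hcoeff.const_mul _).const_add _)

open Filter Topology in
lemma integral_limDiv {p : ℝ} (hp : 1 < p) {φ : Heisenberg n → ℝ} (hφ : ContDiff ℝ 1 φ)
    (hφc : HasCompactSupport φ) (hφ0 : (0 : Heisenberg n) ∉ tsupport φ) :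
    Integrable (limDiv p φ) ∧ ∫ q, limDiv p φ q = 0 := by
  have hev : ∀ᶠ ε : ℝ in 𝓝[>] 0, 0 < ε ∧ ε ≤ 1 := Ioc_mem_nhdsGT one_pos
  have hmeas : ∀ᶠ ε : ℝ in 𝓝[>] 0, AEStronglyMeasurable (regDiv p ε φ) :=
    hev.mono fun ε hε => (continuous_regDiv hp hε.1 hφ).aestronglyMeasurable
  have hle (q : Heisenberg n) : ∀ᶠ ε : ℝ in 𝓝[>] 0, ‖regDiv p ε φ q‖ ≤ regDivBound p φ q :=
    hev.mono fun ε hε => abs_regDiv_le hp hε.1 hε.2 hφ0 q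
  have hB := integrable_regDivBound hp hφ hφc hφ0
  obtain ⟨u, hu⟩ := exists_seq_tendsto (𝓝[>] (0 : ℝ))
  obtain ⟨N, hN⟩ := (hu.eventually hmeas).exists_forall_of_atTop
  constructor
  · refine hB.mono' (aestronglyMeasurable_of_tendsto_ae atTop
      (f := fun k => regDiv p (u (k + N)) φ) (fun k => hN _ (Nat.le_add_left _ _))
      (.of_forall fun q => ((tendsto_regDiv p φ q).comp hu).comp (tendsto_add_atTop_nat N)))
      (.of_forall fun q => le_of_tendsto (tendsto_regDiv p φ q).norm (hle q))
  · refine tendsto_nhds_unique (tendsto_integral_filter_of_dominated_convergence _ hmeas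
      (hev.mono fun ε hε => .of_forall fun q => abs_regDiv_le hp hε.1 hε.2 hφ0 q) hB
      (.of_forall (tendsto_regDiv p φ)))
      (tendsto_const_nhds.congr' (hev.mono fun ε hε => (integral_regDiv hp hε.1 hφ hφc).symm))

/-- The weight `|z|^p / ρ^(2p)` of the Hardy inequality times `|φ|^p`. -/
noncomputable def hardyDensity (p : ℝ) (φ : Heisenberg n → ℝ) (q : Heisenberg n) : ℝ :=
  √(radSq q) ^ p / gauge q ^ (p / 2) * |φ q| ^ p

lemma young_rpow_sub_one {p a b : ℝ} (hp : 1 < p) (ha : 0 ≤ a) (hb : 0 ≤ b) :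
    p * (a * b ^ (p - 1)) ≤ a ^ p + (p - 1) * b ^ p := by
  have hc := Real.HolderConjugate.conjExponent hp
  have h := Real.young_inequality_of_nonneg ha (Real.rpow_nonneg hb (p - 1)) hc
  have hp1 : p - 1 ≠ 0 := by linarith
  have hp0 : p ≠ 0 := by linarith
  rw [← Real.rpow_mul hb, Real.conjExponent, mul_div_cancel₀ _ hp1] at h
  calc p * (a * b ^ (p - 1)) ≤ p * (a ^ p / p + b ^ p / (p / (p - 1))) := by gcongr
    _ = _ := by field_simp

lemma hardyDensity_sub_le_limDiv {p : ℝ} (hp : 1 < p) (hpQ : p < 2 * n + 2)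
    (φ : Heisenberg n → ℝ) (q : Heisenberg n) :
    ((2 * n + 2 - p) / p) ^ p * hardyDensity p φ q - √(heisGradSq φ q) ^ p ≤
      ((2 * n + 2 - p) / p) ^ (p - 1) * limDiv p φ q := by
  have hp0 : 0 < p := by linarith
  set c := (2 * n + 2 - p) / p with hc
  have hc0 : 0 < c := div_pos (by linarith) hp0
  set g := √(heisGradSq φ q)
  have hg : 0 ≤ g := Real.sqrt_nonneg _
  rcases (radSq_nonneg q).eq_or_lt' with hw | hw
  · simp only [hardyDensity, limDiv, hw, gaugeField_of_radSq_eq_zero hw]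
    simp [Real.zero_rpow hp0.ne']
    positivity
  have hN : 0 < gauge q := by unfold gauge; positivity
  set s := √(radSq q) with hs
  set r := √(gauge q) with hr
  have hs0 : 0 < s := Real.sqrt_pos.2 hw
  have hr0 : 0 < r := Real.sqrt_pos.2 hN
  have hsw : s ^ (2 : ℝ) = radSq q := by rw [Real.rpow_two, Real.sq_sqrt hw.le]
  have hrN : r ^ (2 : ℝ) = gauge q := by rw [Real.rpow_two, Real.sq_sqrt hN.le]
  set b := |φ q| * s / r
  have hb : 0 ≤ b := by positivity
  have hdens : hardyDensity p φ q = b ^ p := by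
    rw [hardyDensity, ← hs, ← hrN, ← Real.rpow_mul hr0.le, Real.div_rpow (by positivity) hr0.le,
      Real.mul_rpow (by positivity) hs0.le, mul_div_cancel₀ _ two_ne_zero]
    ring
  have hA : radSq q ^ ((p - 2) / 2) * gauge q ^ (-(p / 2)) = s ^ (p - 2) * r ^ (-p) := by
    rw [← hsw, ← hrN, ← Real.rpow_mul hr0.le, ← Real.rpow_mul hs0.le]
    ring_nf
  have h1 : -(p * |φ q| ^ (p - 1) * (s * r * g)) ≤
      p * |φ q| ^ (p - 2) * φ q * fderiv ℝ φ q (gaugeField q) := by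
    refine neg_le_of_abs_le ?_
    rw [abs_mul, abs_mul_abs_rpow_mul hp]
    gcongr
    exact abs_fderiv_gaugeField_le φ q
  have h2 : s ^ (p - 2) * r ^ (-p) * (|φ q| ^ (p - 1) * (s * r * g)) = b ^ (p - 1) * g := by
    rw [Real.div_rpow (by positivity) hr0.le, Real.mul_rpow (by positivity) hs0.le,
      Real.rpow_neg hr0.le, Real.rpow_sub_one hr0.ne',
      show p - 2 = p - 1 - 1 by ring, Real.rpow_sub_one hs0.ne' (p - 1)]
    field_simp
  have h3 : s ^ (p - 2) * r ^ (-p) * (|φ q| ^ p * radSq q) = b ^ p := by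
    rw [Real.div_rpow (by positivity) hr0.le, Real.mul_rpow (by positivity) hs0.le,
      Real.rpow_neg hr0.le, ← hsw, Real.rpow_sub hs0]
    field_simp
  have hlow : c * p * b ^ p - p * (b ^ (p - 1) * g) ≤ limDiv p φ q := by
    rw [limDiv, hA, ← h2, ← h3, hc, div_mul_cancel₀ _ hp0.ne']
    calc _ = s ^ (p - 2) * r ^ (-p) * (-(p * |φ q| ^ (p - 1) * (s * r * g))
          + |φ q| ^ p * radSq q * (2 * n + 2 - p)) := by ring
      _ ≤ _ := by gcongr
  have hy := young_rpow_sub_one hp hg (mul_nonneg hc0.le hb)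
  rw [Real.mul_rpow hc0.le hb, Real.mul_rpow hc0.le hb] at hy
  have hcp : c ^ p = c ^ (p - 1) * c := by
    rw [← Real.rpow_add_one hc0.ne', sub_add_cancel]
  have hm := mul_le_mul_of_nonneg_left hlow (Real.rpow_nonneg hc0.le (p - 1))
  refine le_trans ?_ hm
  rw [hdens]
  rw [hcp] at hy ⊢
  nlinarith [hy]

end Heisenberg

/-- **L^p Hardy inequality on the Heisenberg group** (inequality (3.5)):
for `Q = 2n+2`, `1 < p < Q` and smooth `φ` with compact support in
`ℝ^{2n+1} \ {0}`, one has
`∫ ‖∇_H φ‖^p ≥ ((Q-p)/p)^p ∫ (|z|^p/(|z|⁴+t²)^{p/2}) |φ|^p`. -/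
theorem hardy_inequality_heisenberg (n : ℕ) (hn : 1 ≤ n) (p : ℝ)
    (hp1 : 1 < p) (hpQ : p < 2 * n + 2)
    (φ : Heisenberg n → ℝ) (hφ : ContDiff ℝ (⊤ : ℕ∞) φ) (hφc : HasCompactSupport φ)
    (hφ0 : (0 : Heisenberg n) ∉ tsupport φ) :
    ∫ q, (Real.sqrt (heisGradSq φ q)) ^ p ≥
      ((2 * n + 2 - p) / p) ^ p *
        ∫ q : Heisenberg n,
          (Real.sqrt (‖q.1‖ ^ 2 + ‖q.2.1‖ ^ 2)) ^ p /
            ((‖q.1‖ ^ 2 + ‖q.2.1‖ ^ 2) ^ 2 + q.2.2 ^ 2) ^ (p / 2) *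
              |φ q| ^ p := by
  open Heisenberg in
  have hp0 : 0 < p := by linarith
  have hφ1 : ContDiff ℝ 1 φ := hφ.of_le (by exact_mod_cast le_top)
  change ((2 * n + 2 - p) / p) ^ p * ∫ q, hardyDensity p φ q ≤ _
  obtain ⟨hint, hzero⟩ := integral_limDiv hp1 hφ1 hφc hφ0
  have hdens : Integrable (hardyDensity p φ) := by
    refine integrable_mul_of_continuousOn hφc hφ0
      (hφ.continuous.abs.rpow_const fun _ => .inr hp0.le) (fun q hq => ?_) ?_
    · simp [image_eq_zero_of_notMem_tsupport hq, Real.zero_rpow hp0.ne']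
    · exact ((contDiff_radSq.continuous.sqrt.rpow_const fun _ => .inr hp0.le).continuousOn).div
        (contDiff_gauge.continuous.rpow_const fun _ => .inr (by positivity)).continuousOn
        fun q hq => (Real.rpow_pos_of_pos (gauge_pos hq) _).ne'
  have hgrad : Integrable fun q => √(heisGradSq φ q) ^ p := by
    refine ((continuous_heisGradSq hφ1).sqrt.rpow_const
      fun _ => .inr hp0.le).integrable_of_hasCompactSupport (.intro hφc fun q hq => ?_)
    simp [heisGradSq_eq_zero_of_notMem_tsupport hq, Real.zero_rpow hp0.ne']
  have h := integral_mono ((hdens.const_mul _).sub hgrad) (hint.const_mul _)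
    (hardyDensity_sub_le_limDiv hp1 hpQ φ)
  simp only [Pi.sub_apply] at h
  rw [integral_sub (hdens.const_mul _) hgrad, integral_const_mul, integral_const_mul, hzero,
    mul_zero] at h
  linarith
end

section
/- The homogeneous norm ρ(z,t) = (|z|⁴ + t²)^{1/4} on the Heisenberg group satisfies the ∞-sub-Laplace equation away from the origin: at every point (z, t) ∈ ℝ^{2n+1} with (z, t) ≠ 0, (1/2) Σ_{j=1}^n [ X_j(‖∇_H ρ‖²) · (X_j ρ) + Y_j(‖∇_H ρ‖²) · (Y_j ρ) ] = 0, where ‖∇_H ρ‖² = Σ_{j=1}^n [(X_j ρ)² + (Y_j ρ)²]. -/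
open MeasureTheory

/-- The squared Euclidean norm `|z|² = ‖x‖² + ‖y‖²` of the horizontal coordinates. -/
noncomputable def heisHorSq {n : ℕ} (q : Heisenberg n) : ℝ :=
  ‖q.1‖ ^ 2 + ‖q.2.1‖ ^ 2

/-- The fourth power `|z|⁴ + t²` of the homogeneous norm. -/
noncomputable def heisGauge {n : ℕ} (q : Heisenberg n) : ℝ :=
  heisHorSq q ^ 2 + q.2.2 ^ 2

lemma heisHorSq_nonneg {n : ℕ} (q : Heisenberg n) : 0 ≤ heisHorSq q := by
  unfold heisHorSq; positivity

lemma heisGauge_pos {n : ℕ} {q : Heisenberg n} (hq : q ≠ 0) : 0 < heisGauge q := by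
  refine lt_of_le_of_ne (by unfold heisGauge; positivity) fun h => hq ?_
  have hw : heisHorSq q = 0 := by
    unfold heisGauge at h; nlinarith [sq_nonneg (heisHorSq q), sq_nonneg q.2.2]
  have ht : q.2.2 = 0 := by
    unfold heisGauge at h; nlinarith [sq_nonneg (heisHorSq q), sq_nonneg q.2.2]
  have hx : ‖q.1‖ = 0 := by
    unfold heisHorSq at hw; nlinarith [sq_nonneg ‖q.1‖, sq_nonneg ‖q.2.1‖]
  have hy : ‖q.2.1‖ = 0 := by
    unfold heisHorSq at hw; nlinarith [sq_nonneg ‖q.1‖, sq_nonneg ‖q.2.1‖]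
  exact Prod.ext (norm_eq_zero.mp hx) (Prod.ext (norm_eq_zero.mp hy) ht)

lemma differentiable_heisHorSq {n : ℕ} : Differentiable ℝ (heisHorSq (n := n)) := by
  unfold heisHorSq
  exact (differentiable_fst.norm_sq ℝ).add (differentiable_snd.fst.norm_sq ℝ)

lemma differentiable_heisGauge {n : ℕ} : Differentiable ℝ (heisGauge (n := n)) := by
  unfold heisGauge
  exact (differentiable_heisHorSq.pow 2).add (differentiable_snd.snd.pow 2)

lemma fderiv_heisHorSq {n : ℕ} (q v : Heisenberg n) :
    fderiv ℝ heisHorSq q v = 2 * inner ℝ q.1 v.1 + 2 * inner ℝ q.2.1 v.2.1 := by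
  have h : HasFDerivAt (heisHorSq (n := n)) _ q :=
    (hasFDerivAt_fst (𝕜 := ℝ) (p := q)).norm_sq.add
      (hasFDerivAt_snd (𝕜 := ℝ) (p := q)).fst.norm_sq
  rw [h.fderiv]
  simp

lemma fderiv_heisGauge {n : ℕ} (q v : Heisenberg n) :
    fderiv ℝ heisGauge q v =
      2 * heisHorSq q * fderiv ℝ heisHorSq q v + 2 * q.2.2 * v.2.2 := by
  have h : HasFDerivAt (heisGauge (n := n)) _ q :=
    ((differentiable_heisHorSq q).hasFDerivAt.pow 2).add
      ((hasFDerivAt_snd (𝕜 := ℝ) (p := q)).snd.pow 2)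
  rw [h.fderiv]
  simp

lemma heisX_heisHorSq {n : ℕ} (j : Fin n) (q : Heisenberg n) :
    heisX j heisHorSq q = 2 * q.1 j := by
  simp [heisX, fderiv_heisHorSq, EuclideanSpace.inner_single_right]

lemma heisY_heisHorSq {n : ℕ} (j : Fin n) (q : Heisenberg n) :
    heisY j heisHorSq q = 2 * q.2.1 j := by
  simp [heisY, fderiv_heisHorSq, EuclideanSpace.inner_single_right]

lemma heisX_heisGauge {n : ℕ} (j : Fin n) (q : Heisenberg n) :
    heisX j heisGauge q = 4 * (heisHorSq q * q.1 j + q.2.2 * q.2.1 j) := by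
  have h := heisX_heisHorSq j q
  unfold heisX at h ⊢
  rw [fderiv_heisGauge, h]
  ring

lemma heisY_heisGauge {n : ℕ} (j : Fin n) (q : Heisenberg n) :
    heisY j heisGauge q = 4 * (heisHorSq q * q.2.1 j - q.2.2 * q.1 j) := by
  have h := heisY_heisHorSq j q
  unfold heisY at h ⊢
  rw [fderiv_heisGauge, h]
  ring

lemma sum_sq_add_sq_eq_heisHorSq {n : ℕ} (q : Heisenberg n) :
    ∑ j : Fin n, (q.1 j ^ 2 + q.2.1 j ^ 2) = heisHorSq q := by
  simp [heisHorSq, EuclideanSpace.norm_sq_eq, Finset.sum_add_distrib]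

lemma heisGradSq_heisGauge {n : ℕ} (q : Heisenberg n) :
    heisGradSq heisGauge q = 16 * heisHorSq q * heisGauge q := by
  have h : ∀ j : Fin n, heisX j heisGauge q ^ 2 + heisY j heisGauge q ^ 2 =
      16 * heisGauge q * (q.1 j ^ 2 + q.2.1 j ^ 2) := fun j => by
    rw [heisX_heisGauge, heisY_heisGauge, heisGauge]; ring
  simp only [heisGradSq, h]
  rw [← Finset.mul_sum, sum_sq_add_sq_eq_heisHorSq]
  ring

/-- The horizontal gradients of `|z|²` and `|z|⁴ + t²` have inner product `8 |z|⁴`. -/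
lemma sum_heisHorSq_mul_heisGauge {n : ℕ} (q : Heisenberg n) :
    ∑ j : Fin n, (heisX j heisHorSq q * heisX j heisGauge q +
      heisY j heisHorSq q * heisY j heisGauge q) = 8 * heisHorSq q ^ 2 := by
  have h : ∀ j : Fin n, heisX j heisHorSq q * heisX j heisGauge q +
      heisY j heisHorSq q * heisY j heisGauge q =
      8 * heisHorSq q * (q.1 j ^ 2 + q.2.1 j ^ 2) := fun j => by
    rw [heisX_heisHorSq, heisY_heisHorSq, heisX_heisGauge, heisY_heisGauge]; ring
  simp only [h]
  rw [← Finset.mul_sum, sum_sq_add_sq_eq_heisHorSq]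
  ring

lemma fderiv_heisRho {n : ℕ} {q : Heisenberg n} (hq : q ≠ 0) :
    fderiv ℝ heisRho q =
      (1 / 4 * heisGauge q ^ (-(3 / 4) : ℝ)) • fderiv ℝ heisGauge q := by
  have h : HasFDerivAt (heisRho (n := n)) _ q :=
    (differentiable_heisGauge q).hasFDerivAt.rpow_const (p := 1 / 4)
      (Or.inl (heisGauge_pos hq).ne')
  rw [h.fderiv]
  norm_num

lemma heisGradSq_heisRho {n : ℕ} {q : Heisenberg n} (hq : q ≠ 0) :
    heisGradSq heisRho q = heisHorSq q * heisGauge q ^ (-(1 / 2) : ℝ) := by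
  have hP := heisGauge_pos hq
  have hpow : (heisGauge q ^ (-(3 / 4) : ℝ)) ^ 2 * heisGauge q =
      heisGauge q ^ (-(1 / 2) : ℝ) := by
    rw [← Real.rpow_mul_natCast hP.le, ← Real.rpow_add_one hP.ne']
    norm_num
  have h : heisGradSq heisRho q =
      (1 / 4 * heisGauge q ^ (-(3 / 4) : ℝ)) ^ 2 * heisGradSq heisGauge q := by
    simp only [heisGradSq, heisX, heisY, fderiv_heisRho hq, smul_apply,
      smul_eq_mul, Finset.mul_sum]
    exact Finset.sum_congr rfl fun j _ => by ring
  rw [h, heisGradSq_heisGauge, ← hpow]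
  ring

lemma fderiv_heisGradSq_heisRho {n : ℕ} {q : Heisenberg n} (hq : q ≠ 0) (v : Heisenberg n) :
    fderiv ℝ (heisGradSq heisRho) q v =
      heisGauge q ^ (-(3 / 2) : ℝ) *
        (heisGauge q * fderiv ℝ heisHorSq q v -
          1 / 2 * heisHorSq q * fderiv ℝ heisGauge q v) := by
  have hP := heisGauge_pos hq
  have hpow : heisGauge q ^ (-(1 / 2) : ℝ) =
      heisGauge q ^ (-(3 / 2) : ℝ) * heisGauge q := by
    rw [← Real.rpow_add_one hP.ne']
    norm_num
  have heq : heisGradSq heisRho =ᶠ[nhds q]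
      fun p => heisHorSq p * heisGauge p ^ (-(1 / 2) : ℝ) :=
    (eventually_ne_nhds hq).mono fun p hp => heisGradSq_heisRho hp
  have h := (differentiable_heisHorSq q).hasFDerivAt.fun_mul
    ((differentiable_heisGauge q).hasFDerivAt.rpow_const (p := -(1 / 2)) (Or.inl hP.ne'))
  have hexp : (-(1 / 2) - 1 : ℝ) = -(3 / 2) := by norm_num
  rw [heq.fderiv_eq, h.fderiv, hexp, hpow]
  simp only [add_apply, smul_apply, smul_eq_mul]
  ring

/-- **The Heisenberg group is polarizable**: the homogeneous norm
`ρ(z,t) = (|z|⁴+t²)^{1/4}` satisfies the ∞-sub-Laplace equation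
`Δ_{H,∞} ρ = ½ ⟨∇_H(‖∇_H ρ‖²), ∇_H ρ⟩ = 0` away from the origin. -/
theorem heis_rho_infty_harmonic (n : ℕ) (q : Heisenberg n) (hq : q ≠ 0) :
    (1 / 2 : ℝ) * ∑ j : Fin n,
        (heisX j (heisGradSq (heisRho (n := n))) q * heisX j (heisRho (n := n)) q +
         heisY j (heisGradSq (heisRho (n := n))) q * heisY j (heisRho (n := n)) q) = 0 := by
  have h : ∀ j : Fin n,
      heisX j (heisGradSq heisRho) q * heisX j heisRho q +
        heisY j (heisGradSq heisRho) q * heisY j heisRho q =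
      1 / 4 * heisGauge q ^ (-(3 / 4) : ℝ) * heisGauge q ^ (-(3 / 2) : ℝ) *
        (heisGauge q * (heisX j heisHorSq q * heisX j heisGauge q +
            heisY j heisHorSq q * heisY j heisGauge q) -
          1 / 2 * heisHorSq q * (heisX j heisGauge q ^ 2 + heisY j heisGauge q ^ 2)) :=
    fun j => by
      simp only [heisX, heisY, fderiv_heisGradSq_heisRho hq, fderiv_heisRho hq,
        smul_apply, smul_eq_mul]
      ring
  have hgrad := heisGradSq_heisGauge q
  unfold heisGradSq at hgrad
  rw [Finset.sum_congr rfl fun j _ => h j, ← Finset.mul_sum, Finset.sum_sub_distrib,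
    ← Finset.mul_sum, ← Finset.mul_sum, sum_heisHorSq_mul_heisGauge, hgrad]
  ring
end

section
/- Let n ≥ 1, Q = 2n + 2, 1 < p < ∞ with p ≠ Q, and set Γ(z,t) = ρ(z,t)^{(p−Q)/(p−1)}, where ρ(z,t) = (|z|⁴ + t²)^{1/4}. Then Γ is horizontally p-harmonic off the center axis: at every point (z, t) ∈ ℝ^{2n+1} with z ≠ 0, Σ_{j=1}^n [ X_j( ‖∇_H Γ‖^{p−2} X_j Γ ) + Y_j( ‖∇_H Γ‖^{p−2} Y_j Γ ) ] = 0. -/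
open MeasureTheory

/-- The squared horizontal radius `|z|² = ‖x‖² + ‖y‖²`. -/
noncomputable def heisR {n : ℕ} (q : Heisenberg n) : ℝ := ‖q.1‖ ^ 2 + ‖q.2.1‖ ^ 2

/-- The fourth power `|z|⁴ + t²` of the homogeneous norm. -/
noncomputable def heisD {n : ℕ} (q : Heisenberg n) : ℝ := heisR q ^ 2 + q.2.2 ^ 2

/-- The differential of `heisR` at `q`. -/
noncomputable def heisR' {n : ℕ} (q : Heisenberg n) : Heisenberg n →L[ℝ] ℝ :=
  (2 • innerSL ℝ q.1).comp (ContinuousLinearMap.fst ℝ _ _) +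
    (2 • innerSL ℝ q.2.1).comp
      ((ContinuousLinearMap.fst ℝ _ _).comp (ContinuousLinearMap.snd ℝ _ _))

/-- The differential of the central coordinate `t`. -/
noncomputable def heisT' (n : ℕ) : Heisenberg n →L[ℝ] ℝ :=
  (ContinuousLinearMap.snd ℝ _ _).comp (ContinuousLinearMap.snd ℝ _ _)

/-- The differential of `heisD` at `q`. -/
noncomputable def heisD' {n : ℕ} (q : Heisenberg n) : Heisenberg n →L[ℝ] ℝ :=
  (2 * heisR q) • heisR' q + (2 * q.2.2) • heisT' n

section Derivatives

variable {n : ℕ}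

lemma hasFDerivAt_heisR (q : Heisenberg n) : HasFDerivAt heisR (heisR' q) q :=
  (hasFDerivAt_fst.norm_sq.congr_fderiv (by ext <;> simp)).add
    ((hasFDerivAt_fst.comp q hasFDerivAt_snd).norm_sq.congr_fderiv (by ext <;> simp))

lemma hasFDerivAt_heisT (q : Heisenberg n) :
    HasFDerivAt (fun w : Heisenberg n => w.2.2) (heisT' n) q :=
  (heisT' n).hasFDerivAt

lemma hasFDerivAt_heisD (q : Heisenberg n) : HasFDerivAt heisD (heisD' q) q := by
  refine (((hasFDerivAt_heisR q).pow 2).add ((hasFDerivAt_heisT q).pow 2)).congr_fderiv ?_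
  simp [heisD']

lemma hasFDerivAt_coord_x (j : Fin n) (q : Heisenberg n) :
    HasFDerivAt (fun w : Heisenberg n => w.1 j)
      ((EuclideanSpace.proj j : EuclideanSpace ℝ (Fin n) →L[ℝ] ℝ).comp
        (ContinuousLinearMap.fst ℝ _ _)) q :=
  (EuclideanSpace.proj j : EuclideanSpace ℝ (Fin n) →L[ℝ] ℝ).hasFDerivAt.comp q hasFDerivAt_fst

lemma hasFDerivAt_coord_y (j : Fin n) (q : Heisenberg n) :
    HasFDerivAt (fun w : Heisenberg n => w.2.1 j)
      ((EuclideanSpace.proj j : EuclideanSpace ℝ (Fin n) →L[ℝ] ℝ).comp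
        ((ContinuousLinearMap.fst ℝ _ _).comp (ContinuousLinearMap.snd ℝ _ _))) q :=
  (EuclideanSpace.proj j : EuclideanSpace ℝ (Fin n) →L[ℝ] ℝ).hasFDerivAt.comp q
    (hasFDerivAt_fst.comp q hasFDerivAt_snd)

lemma heisR'_X (j : Fin n) (q : Heisenberg n) (s : ℝ) :
    heisR' q (EuclideanSpace.single j 1, 0, s) = 2 * q.1 j := by
  simp [heisR', EuclideanSpace.inner_single_right]

lemma heisR'_Y (j : Fin n) (q : Heisenberg n) (s : ℝ) :
    heisR' q (0, EuclideanSpace.single j 1, s) = 2 * q.2.1 j := by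
  simp [heisR', EuclideanSpace.inner_single_right]

lemma heisD'_X (j : Fin n) (q : Heisenberg n) :
    heisD' q (EuclideanSpace.single j 1, 0, 2 * q.2.1 j) =
      4 * (heisR q * q.1 j + q.2.1 j * q.2.2) := by
  simp [heisD', heisR'_X, heisT']
  ring

lemma heisD'_Y (j : Fin n) (q : Heisenberg n) :
    heisD' q (0, EuclideanSpace.single j 1, -(2 * q.1 j)) =
      4 * (heisR q * q.2.1 j - q.1 j * q.2.2) := by
  simp [heisD', heisR'_Y, heisT']
  ring

lemma heisR_eq_sum (q : Heisenberg n) : heisR q = ∑ j, (q.1 j ^ 2 + q.2.1 j ^ 2) := by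
  simp [heisR, EuclideanSpace.real_norm_sq_eq, Finset.sum_add_distrib]

lemma heisD_pos {q : Heisenberg n} (h : 0 < heisR q) : 0 < heisD q := by
  unfold heisD; positivity

lemma heisRho_rpow (a : ℝ) (q : Heisenberg n) : heisRho q ^ a = heisD q ^ (a / 4) := by
  change (heisD q ^ ((1 : ℝ) / 4)) ^ a = _
  rw [← Real.rpow_mul (by unfold heisD; positivity)]
  congr 1
  ring

lemma hasFDerivAt_heisD_rpow (c : ℝ) {q : Heisenberg n} (h : 0 < heisR q) :
    HasFDerivAt (fun w => heisD w ^ c) ((c * heisD q ^ (c - 1)) • heisD' q) q :=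
  (hasFDerivAt_heisD q).rpow_const (Or.inl (heisD_pos h).ne')

lemma heisX_heisD_rpow (c : ℝ) (j : Fin n) {q : Heisenberg n} (h : 0 < heisR q) :
    heisX j (fun w => heisD w ^ c) q =
      c * heisD q ^ (c - 1) * (4 * (heisR q * q.1 j + q.2.1 j * q.2.2)) := by
  rw [heisX, (hasFDerivAt_heisD_rpow c h).fderiv]
  simp [heisD'_X]

lemma heisY_heisD_rpow (c : ℝ) (j : Fin n) {q : Heisenberg n} (h : 0 < heisR q) :
    heisY j (fun w => heisD w ^ c) q =
      c * heisD q ^ (c - 1) * (4 * (heisR q * q.2.1 j - q.1 j * q.2.2)) := by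
  rw [heisY, (hasFDerivAt_heisD_rpow c h).fderiv]
  simp [heisD'_Y]

lemma heisGradSq_heisD_rpow (c : ℝ) {q : Heisenberg n} (h : 0 < heisR q) :
    heisGradSq (fun w => heisD w ^ c) q =
      (4 * c) ^ 2 * (heisR q * heisD q ^ (2 * c - 1)) := by
  have hD := heisD_pos h
  have hpow : heisD q ^ (2 * c - 1) = (heisD q ^ (c - 1)) ^ 2 * heisD q := by
    rw [← Real.rpow_natCast, ← Real.rpow_mul hD.le, ← Real.rpow_add_one hD.ne']
    congr 1
    push_cast
    ring
  rw [hpow, heisGradSq]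
  calc _ = ∑ j, (4 * c) ^ 2 * ((heisD q ^ (c - 1)) ^ 2 * heisD q) *
        (q.1 j ^ 2 + q.2.1 j ^ 2) := by
        refine Finset.sum_congr rfl fun j _ => ?_
        rw [heisX_heisD_rpow c j h, heisY_heisD_rpow c j h]
        simp only [heisD]
        ring
    _ = _ := by
        rw [← Finset.mul_sum, ← heisR_eq_sum]
        ring

lemma sqrt_heisGradSq_rpow (c s : ℝ) {q : Heisenberg n} (h : 0 < heisR q) :
    Real.sqrt (heisGradSq (fun w => heisD w ^ c) q) ^ s =
      |4 * c| ^ s * (heisR q ^ (s / 2) * heisD q ^ ((2 * c - 1) * (s / 2))) := by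
  have hD := heisD_pos h
  rw [heisGradSq_heisD_rpow c h, Real.sqrt_mul (sq_nonneg _), Real.sqrt_sq_eq_abs,
    Real.mul_rpow (abs_nonneg _) (Real.sqrt_nonneg _), Real.sqrt_eq_rpow,
    ← Real.rpow_mul (by positivity), Real.mul_rpow h.le (by positivity), ← Real.rpow_mul hD.le,
    one_div_mul_eq_div]

/-- The differential of `|z|^{2α} ρ^{4β} P` in terms of its logarithmic derivative. -/
lemma fderiv_weight_mul (K α β : ℝ) {q : Heisenberg n} (h : 0 < heisR q)
    {P : Heisenberg n → ℝ} {P' : Heisenberg n →L[ℝ] ℝ} (hP : HasFDerivAt P P' q)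
    (v : Heisenberg n) :
    fderiv ℝ (fun w => K * (heisR w ^ α * heisD w ^ β) * P w) q v =
      K * (heisR q ^ α * heisD q ^ β) *
        ((α * heisR' q v / heisR q + β * heisD' q v / heisD q) * P q + P' v) := by
  have hD := heisD_pos h
  have hR := (hasFDerivAt_heisR q).rpow_const (p := α) (Or.inl h.ne')
  have hfd := (((hR.mul (hasFDerivAt_heisD_rpow β h)).const_mul K).mul hP).fderiv
  refine (congrArg (fun L : Heisenberg n →L[ℝ] ℝ => L v) hfd).trans ?_
  simp [Real.rpow_sub_one h.ne', Real.rpow_sub_one hD.ne']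
  field_simp
  ring

lemma eventually_heisR_pos {q : Heisenberg n} (h : 0 < heisR q) :
    ∀ᶠ w in nhds q, 0 < heisR w :=
  (hasFDerivAt_heisR q).continuousAt.eventually_const_lt h

lemma heisX_flux (c s : ℝ) (j : Fin n) {q : Heisenberg n} (h : 0 < heisR q) :
    heisX j (fun w => Real.sqrt (heisGradSq (fun v => heisD v ^ c) w) ^ s *
        heisX j (fun v => heisD v ^ c) w) q =
      4 * c * |4 * c| ^ s *
          (heisR q ^ (s / 2) * heisD q ^ ((2 * c - 1) * (s / 2) + (c - 1))) *
        ((s * q.1 j / heisR q + ((2 * c - 1) * (s / 2) + (c - 1)) *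
              (4 * (heisR q * q.1 j + q.2.1 j * q.2.2)) / heisD q) *
            (heisR q * q.1 j + q.2.1 j * q.2.2) +
          (2 * q.1 j ^ 2 + heisR q + 2 * q.2.1 j ^ 2)) := by
  have hP := ((hasFDerivAt_heisR q).mul (hasFDerivAt_coord_x j q)).add
    ((hasFDerivAt_coord_y j q).mul (hasFDerivAt_heisT q))
  have key := fderiv_weight_mul (4 * c * |4 * c| ^ s) (s / 2)
    ((2 * c - 1) * (s / 2) + (c - 1)) h hP (EuclideanSpace.single j 1, 0, 2 * q.2.1 j)
  rw [heisX, Filter.EventuallyEq.fderiv_eq (f := fun w => 4 * c * |4 * c| ^ s *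
    (heisR w ^ (s / 2) * heisD w ^ ((2 * c - 1) * (s / 2) + (c - 1))) *
      (heisR w * w.1 j + w.2.1 j * w.2.2))]
  · refine key.trans ?_
    simp [heisD'_X, heisR'_X, heisT']
    left
    ring
  · filter_upwards [eventually_heisR_pos h] with w hw
    rw [sqrt_heisGradSq_rpow c s hw, heisX_heisD_rpow c j hw, Real.rpow_add (heisD_pos hw)]
    ring

lemma heisY_flux (c s : ℝ) (j : Fin n) {q : Heisenberg n} (h : 0 < heisR q) :
    heisY j (fun w => Real.sqrt (heisGradSq (fun v => heisD v ^ c) w) ^ s *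
        heisY j (fun v => heisD v ^ c) w) q =
      4 * c * |4 * c| ^ s *
          (heisR q ^ (s / 2) * heisD q ^ ((2 * c - 1) * (s / 2) + (c - 1))) *
        ((s * q.2.1 j / heisR q + ((2 * c - 1) * (s / 2) + (c - 1)) *
              (4 * (heisR q * q.2.1 j - q.1 j * q.2.2)) / heisD q) *
            (heisR q * q.2.1 j - q.1 j * q.2.2) +
          (2 * q.2.1 j ^ 2 + heisR q + 2 * q.1 j ^ 2)) := by
  have hP := ((hasFDerivAt_heisR q).mul (hasFDerivAt_coord_y j q)).sub
    ((hasFDerivAt_coord_x j q).mul (hasFDerivAt_heisT q))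
  have key := fderiv_weight_mul (4 * c * |4 * c| ^ s) (s / 2)
    ((2 * c - 1) * (s / 2) + (c - 1)) h hP (0, EuclideanSpace.single j 1, -(2 * q.1 j))
  rw [heisY, Filter.EventuallyEq.fderiv_eq (f := fun w => 4 * c * |4 * c| ^ s *
    (heisR w ^ (s / 2) * heisD w ^ ((2 * c - 1) * (s / 2) + (c - 1))) *
      (heisR w * w.2.1 j - w.1 j * w.2.2))]
  · refine key.trans ?_
    simp [heisD'_Y, heisR'_Y, heisT']
    left
    ring
  · filter_upwards [eventually_heisR_pos h] with w hw
    rw [sqrt_heisGradSq_rpow c s hw, heisY_heisD_rpow c j hw, Real.rpow_add (heisD_pos hw)]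
    ring

/-- The horizontal divergence of `‖∇_H u‖^s ∇_H u` for `u = ρ^{4c}`. -/
lemma sum_flux (c s : ℝ) {q : Heisenberg n} (h : 0 < heisR q) :
    ∑ j : Fin n,
        (heisX j (fun w => Real.sqrt (heisGradSq (fun v => heisD v ^ c) w) ^ s *
            heisX j (fun v => heisD v ^ c) w) q +
          heisY j (fun w => Real.sqrt (heisGradSq (fun v => heisD v ^ c) w) ^ s *
            heisY j (fun v => heisD v ^ c) w) q) =
      4 * c * |4 * c| ^ s *
          (heisR q ^ (s / 2) * heisD q ^ ((2 * c - 1) * (s / 2) + (c - 1))) *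
        ((4 * c * (s + 1) - s + 2 * n) * heisR q) := by
  have hD := heisD_pos h
  set M := 4 * c * |4 * c| ^ s *
    (heisR q ^ (s / 2) * heisD q ^ ((2 * c - 1) * (s / 2) + (c - 1))) with hM
  calc _ = ∑ j : Fin n, M * ((4 * c * (s + 1) - s) * (q.1 j ^ 2 + q.2.1 j ^ 2) +
        2 * heisR q) := by
        refine Finset.sum_congr rfl fun j _ => ?_
        rw [heisX_flux c s j h, heisY_flux c s j h, ← hM, ← mul_add]
        congr 1
        have hDe : heisD q = heisR q ^ 2 + q.2.2 ^ 2 := rfl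
        field_simp
        rw [hDe]
        ring
    _ = _ := by
        rw [← Finset.mul_sum, Finset.sum_add_distrib, ← Finset.mul_sum, ← heisR_eq_sum]
        simp
        left
        ring

end Derivatives

/-- **Capogna–Danielli–Garofalo fundamental solution for the p-sub-Laplacian**
(Heisenberg instance of the Balogh–Tyson formula): for `1 < p`, `p ≠ Q = 2n+2`,
the function `Γ = ρ^{(p−Q)/(p−1)}` is horizontally p-harmonic at every point
with `z = (x,y) ≠ 0`:
`Σⱼ [Xⱼ(‖∇_H Γ‖^{p−2} XⱼΓ) + Yⱼ(‖∇_H Γ‖^{p−2} YⱼΓ)] = 0`. -/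
theorem heis_p_fundamental_solution (n : ℕ) (hn : 1 ≤ n) (p : ℝ)
    (hp1 : 1 < p) (hpQ : p ≠ 2 * n + 2) (q : Heisenberg n)
    (hz : (q.1, q.2.1) ≠ 0) :
    ∑ j : Fin n,
        (heisX j (fun w =>
            Real.sqrt (heisGradSq
                (fun v => heisRho v ^ ((p - (2 * n + 2)) / (p - 1))) w) ^ (p - 2) *
              heisX j (fun v => heisRho v ^ ((p - (2 * n + 2)) / (p - 1))) w) q +
         heisY j (fun w =>
            Real.sqrt (heisGradSq
                (fun v => heisRho v ^ ((p - (2 * n + 2)) / (p - 1))) w) ^ (p - 2) *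
              heisY j (fun v => heisRho v ^ ((p - (2 * n + 2)) / (p - 1))) w) q) = 0 := by
  have h : 0 < heisR q := by
    have h1 : q.1 ≠ 0 ∨ q.2.1 ≠ 0 := by
      by_contra! h0
      exact hz (Prod.ext h0.1 h0.2)
    unfold heisR
    rcases h1 with h1 | h1
    · have := norm_pos_iff.mpr h1
      positivity
    · have := norm_pos_iff.mpr h1
      positivity
  have hp : p - 1 ≠ 0 := by linarith
  simp_rw [heisRho_rpow]
  rw [sum_flux _ _ h]
  have hexp : 4 * ((p - (2 * n + 2)) / (p - 1) / 4) * (p - 2 + 1) - (p - 2) + 2 * n = 0 := by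
    have : p - 2 + 1 = p - 1 := by ring
    rw [this]
    field_simp
    ring
  rw [hexp, zero_mul, mul_zero]
end
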